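/- arXiv:1602.06922 — 2 statements merged into one kernel-verified Lean document; each statement's English description precedes it below -/
import Mathlib

section
/- Fix 0 < R < 2 and c > 1 with cR < 2. There is a constant C > 0 such that the following holds. For each d = 2^n (n large enough that ln ln d > 0), set m = m(d) = ⌈C (ln d)^5 (ln ln d)^4⌉ and let d' = d'(d) be any sequence of integers with m ≤ d' ≤ d; let h_F denote the fast cross-polytope hash with these parameters. Then for any sequences of unit vectors x_d, y_d ∈ S^{d−1} with ‖x_d − y_d‖₂ = R and x'_d, y'_d ∈ S^{d−1} with ‖x'_d − y'_d‖₂ = cR, the sensitivity exponent ρ_d = ln(1/Pr[h_F(x_d) = h_F(y_d)]) / ln(1/Pr[h_F(x'_d) = h_F(y'_d)]) satisfies lim_{n→∞} ρ_d = (1/c²)·(4 − c²R²)/(4 − R²). -/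
open MeasureTheory ProbabilityTheory Filter
open scoped ENNReal

/-- The law of a `k × m` matrix with i.i.d. standard Gaussian entries. -/
noncomputable def gaussMatrix (k m : ℕ) : Measure (Fin k → Fin m → ℝ) :=
  Measure.pi fun _ => Measure.pi fun _ => gaussianReal 0 1

/-- `(Av)_i` for a matrix `A` given by rows and a vector `v`. -/
def mvMul {k m : ℕ} (A : Fin k → Fin m → ℝ) (v : Fin m → ℝ) (i : Fin k) : ℝ :=
  ∑ j, A i j * v j

/-- The event that `v` cross-polytope hashes to `s·e_i` under `A`, via strict inequalities. -/
def hashAt {k m : ℕ} (A : Fin k → Fin m → ℝ) (v : Fin m → ℝ) (i : Fin k) (s : ℝ) : Prop :=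
  ∀ j, j ≠ i → |mvMul A v j| < s * mvMul A v i

/-- The event that `v` and `w` receive the same cross-polytope hash under `A`. -/
def collide {k m : ℕ} (A : Fin k → Fin m → ℝ) (v w : Fin m → ℝ) : Prop :=
  ∃ (i : Fin k) (s : ℝ), (s = 1 ∨ s = -1) ∧ hashAt A v i s ∧ hashAt A w i s

/-- The uniform probability measure on a finite type (normalized counting measure). -/
noncomputable def uniformCount (α : Type*) [MeasurableSpace α] : Measure α :=
  (Nat.card α : ℝ≥0∞)⁻¹ • Measure.count

/-- Entry `(i,j)` of the `2^n × 2^n` Hadamard matrix: `(−1)^{⟨i,j⟩}` where `⟨i,j⟩` is the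
`F₂` inner product of the binary expansions of `i` and `j`. -/
noncomputable def hadamardEntry (n : ℕ) (i j : Fin (2 ^ n)) : ℝ :=
  (-1 : ℝ) ^ (∑ k ∈ Finset.range n, ((i : ℕ) >>> k) % 2 * (((j : ℕ) >>> k) % 2))

/-- The sign `±1` associated to a Rademacher bit. -/
def signOf (b : Bool) : ℝ := if b then 1 else -1

/-- `x̃ = (1/√m) H_S D_b x`: the fast JL embedding of `x ∈ ℝ^{2^n}` into `ℝ^m`, where the
`m`-element subset `S` is encoded by the strictly monotone map `σ : Fin m → Fin 2^n` and the
Rademacher signs by `b`. -/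
noncomputable def fastEmbed (n m : ℕ) (σ : Fin m → Fin (2 ^ n)) (b : Fin (2 ^ n) → Bool)
    (x : Fin (2 ^ n) → ℝ) (j : Fin m) : ℝ :=
  (Real.sqrt m)⁻¹ * ∑ k, hadamardEntry n (σ j) k * signOf (b k) * x k

/-- The joint law of the randomness of the fast cross-polytope hash:
a uniformly random `m`-element subset `S ⊆ {1,…,2^n}` (encoded as a strictly monotone map),
i.i.d. Rademacher signs, and an independent `d' × m` i.i.d. standard Gaussian matrix. -/
noncomputable def fastMeasure (n m d' : ℕ) :
    Measure ({σ : Fin m → Fin (2 ^ n) // StrictMono σ} ×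
      (Fin (2 ^ n) → Bool) × (Fin d' → Fin m → ℝ)) :=
  (uniformCount {σ : Fin m → Fin (2 ^ n) // StrictMono σ}).prod
    ((uniformCount (Fin (2 ^ n) → Bool)).prod (gaussMatrix d' m))

/-- The collision probability `Pr[h_F(x) = h_F(y)]` of the fast cross-polytope hash
`h_F(x) = argmin_{±e_i} ‖G x̃ / ‖G x̃‖ − u‖`, `x̃ = (1/√m) H_S D_b x`, over the joint
randomness of `(S, b, G)`. -/
noncomputable def fastCollProb (n m d' : ℕ) (x y : Fin (2 ^ n) → ℝ) : ℝ :=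
  (fastMeasure n m d'
    {ω | collide ω.2.2 (fastEmbed n m ω.1.1 ω.2.1 x) (fastEmbed n m ω.1.1 ω.2.1 y)}).toReal

/-- The embedding dimension `m = ⌈C (ln d)⁵ (ln ln d)⁴⌉`. -/
noncomputable def emDim (C : ℝ) (d : ℕ) : ℕ :=
  ⌈C * (Real.log d) ^ 5 * (Real.log (Real.log d)) ^ 4⌉₊

/-- The standard Gaussian law on `ℝ^m`. -/
noncomputable abbrev stdRow (m : ℕ) : Measure (Fin m → ℝ) :=
  Measure.pi fun _ => gaussianReal 0 1

lemma hasGaussianLaw_stdRow (m : ℕ) : HasGaussianLaw (fun g : Fin m → ℝ => (g ·)) (stdRow m) := by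
  refine iIndepFun.hasGaussianLaw (X := fun i (g : Fin m → ℝ) => g i) (fun i => ?_)
    (iIndepFun_pi (X := fun _ x => x) (fun _ => aemeasurable_id))
  have := (measurePreserving_eval (fun _ : Fin m => gaussianReal 0 1) i).map_eq
  constructor
  change IsGaussian ((stdRow m).map (Function.eval i))
  rw [this]; infer_instance

lemma integral_eval_stdRow (m : ℕ) (i : Fin m) : ∫ g, g i ∂(stdRow m) = 0 := by
  have := integral_comp_eval (μ := fun _ : Fin m => gaussianReal 0 1) (i := i) (f := fun x : ℝ => x)
    (by fun_prop)
  rw [this]; simp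

lemma memLp_eval_stdRow (m : ℕ) (i : Fin m) : MemLp (fun g : Fin m → ℝ => g i) 2 (stdRow m) :=
  ((hasGaussianLaw_stdRow m).eval i).memLp_two

lemma variance_linear_stdRow {m : ℕ} (a : Fin m → ℝ) :
    Var[fun g => ∑ j, g j * a j; stdRow m] = ∑ j, a j ^ 2 := by
  have := variance_sum_pi (μ := fun _ : Fin m => gaussianReal 0 1) (X := fun j x => x * a j)
    (fun i => (memLp_id_gaussianReal' 2 (by simp)).mul_const (a i))
  have e : (fun g : Fin m → ℝ => ∑ j, g j * a j) = ∑ i, fun ω => ω i * a i := by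
    ext g; simp
  rw [e, this]
  refine Finset.sum_congr rfl fun i _ => ?_
  rw [variance_mul_const]
  simp

lemma map_linear_stdRow {m : ℕ} (a : Fin m → ℝ) :
    (stdRow m).map (fun g => ∑ j, g j * a j) = gaussianReal 0 (∑ j, a j ^ 2).toNNReal := by
  have h : HasGaussianLaw (fun g : Fin m → ℝ => ∑ j, g j * a j) (stdRow m) :=
    HasGaussianLaw.map_fun (L := ∑ j, (a j) • (ContinuousLinearMap.proj j : (Fin m → ℝ) →L[ℝ] ℝ))
      (hasGaussianLaw_stdRow m) |> fun h => by simpa [mul_comm] using h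
  rw [h.map_eq_gaussianReal, variance_linear_stdRow]
  congr 1
  rw [integral_finsetSum]
  · simp [integral_mul_const, integral_eval_stdRow]
  · intro i _
    exact ((memLp_eval_stdRow m i).integrable (by norm_num)).mul_const _

lemma indepFun_linear_stdRow {m : ℕ} (u w : Fin m → ℝ) (h : ∑ j, u j * w j = 0) :
    IndepFun (fun g => ∑ j, g j * u j) (fun g => ∑ j, g j * w j) (stdRow m) := by
  have hg := hasGaussianLaw_stdRow m
  have hp := HasGaussianLaw.map_fun
    (L := (∑ j, (u j) • (ContinuousLinearMap.proj j : (Fin m → ℝ) →L[ℝ] ℝ)).prod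
      (∑ j, (w j) • (ContinuousLinearMap.proj j : (Fin m → ℝ) →L[ℝ] ℝ))) hg
  have hp' : HasGaussianLaw (fun g : Fin m → ℝ => (∑ j, g j * u j, ∑ j, g j * w j))
      (stdRow m) := by
    simpa [mul_comm] using hp
  refine hp'.indepFun_of_covariance_eq_zero ?_
  have hm : ∀ a : Fin m → ℝ, MemLp (fun g : Fin m → ℝ => ∑ j, g j * a j) 2 (stdRow m) := fun a =>
    memLp_finsetSum _ fun j _ => (memLp_eval_stdRow m j).mul_const _
  have h1 := variance_fun_add (hm u) (hm w)
  have e : (fun g : Fin m → ℝ => ∑ j, g j * u j + ∑ j, g j * w j)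
    = fun g => ∑ j, g j * (u j + w j) := by
    ext g; rw [← Finset.sum_add_distrib]; simp [mul_add]
  rw [e] at h1
  simp only [variance_linear_stdRow] at h1
  have e2 : ∑ j, (u j + w j) ^ 2 = ∑ j, u j ^ 2 + 2 * ∑ j, u j * w j + ∑ j, w j ^ 2 := by
    rw [Finset.mul_sum, ← Finset.sum_add_distrib, ← Finset.sum_add_distrib]
    exact Finset.sum_congr rfl fun i _ => by ring
  rw [e2, h] at h1
  linarith

/-- Sub-Gaussian upper tail. -/
lemma gaussianReal_Ioi_le (v : NNReal) {t σ : ℝ} (ht : 0 ≤ t) (hσ : 0 < σ) (hv : v ≤ σ) :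
    (gaussianReal 0 v).real (Set.Ioi t) ≤ Real.exp (-t ^ 2 / (2 * σ)) := by
  have h := measure_ge_le_exp_mul_mgf (μ := gaussianReal 0 v) (X := id) t (t := t / σ)
    (by positivity) (integrable_exp_mul_gaussianReal _)
  rw [mgf_id_gaussianReal, ← Real.exp_add] at h
  refine (measureReal_mono (fun x hx => le_of_lt (Set.mem_Ioi.1 hx))).trans (h.trans ?_)
  apply Real.exp_le_exp.2
  have h1 : (v : ℝ) * (t / σ) ^ 2 / 2 ≤ σ * (t / σ) ^ 2 / 2 := by gcongr
  have h2 : -t ^ 2 / (2 * σ) = -(t / σ) * t + σ * (t / σ) ^ 2 / 2 := by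
    field_simp; ring
  rw [h2]
  linarith

lemma gaussianReal_Ioi_ge {t : ℝ} (ht : 0 ≤ t) :
    (1 / 3) * Real.exp (-(t + 1) ^ 2 / 2) ≤ (gaussianReal 0 1).real (Set.Ioi t) := by
  have h1 : (gaussianReal 0 1).real (Set.Ioc t (t + 1)) ≤ (gaussianReal 0 1).real (Set.Ioi t) :=
    measureReal_mono Set.Ioc_subset_Ioi_self
  refine le_trans ?_ h1
  rw [measureReal_def, gaussianReal_apply_eq_integral _ one_ne_zero,
    ENNReal.toReal_ofReal (by
      exact integral_nonneg fun x => gaussianPDFReal_nonneg _ _ _)]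
  have : ∀ x ∈ Set.Ioc t (t + 1), (1 / 3) * Real.exp (-(t + 1) ^ 2 / 2) ≤
      gaussianPDFReal 0 1 x := by
    intro x hx
    rw [gaussianPDFReal]
    simp only [NNReal.coe_one, mul_one, sub_zero]
    gcongr
    · rw [one_div]
      apply inv_anti₀ (by positivity)
      rw [Real.sqrt_le_left (by norm_num)]
      nlinarith [Real.pi_lt_d2]
    · linarith [hx.1]
    · exact hx.2
  have h2 := setIntegral_mono_on (μ := volume) (s := Set.Ioc t (t + 1))
    (f := fun _ => (1 / 3) * Real.exp (-(t + 1) ^ 2 / 2)) (g := gaussianPDFReal 0 1)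
    (integrableOn_const (by simp)) (integrable_gaussianPDFReal 0 1).integrableOn measurableSet_Ioc this
  simpa using h2

lemma measurable_linear {m : ℕ} (a : Fin m → ℝ) :
    Measurable fun g : Fin m → ℝ => ∑ j, g j * a j := by fun_prop

lemma stdRow_tail_le {m : ℕ} (a : Fin m → ℝ) {t σ : ℝ} (ht : 0 ≤ t) (hσ : 0 < σ)
    (ha : ∑ j, a j ^ 2 ≤ σ) :
    (stdRow m).real {g | t < ∑ j, g j * a j} ≤ Real.exp (-t ^ 2 / (2 * σ)) := by
  have h := gaussianReal_Ioi_le (∑ j, a j ^ 2).toNNReal ht hσ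
    (by rwa [Real.coe_toNNReal _ (Finset.sum_nonneg fun i _ => sq_nonneg _)])
  rwa [← map_linear_stdRow, map_measureReal_apply (measurable_linear a) measurableSet_Ioi] at h

lemma stdRow_abs_tail_le {m : ℕ} (a : Fin m → ℝ) {t σ : ℝ} (ht : 0 ≤ t) (hσ : 0 < σ)
    (ha : ∑ j, a j ^ 2 ≤ σ) :
    (stdRow m).real {g | t < |∑ j, g j * a j|} ≤ 2 * Real.exp (-t ^ 2 / (2 * σ)) := by
  have h1 := stdRow_tail_le a ht hσ ha
  have h2 := stdRow_tail_le (fun j => - a j) ht hσ (by simpa using ha)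
  have : {g : Fin m → ℝ | t < |∑ j, g j * a j|} ⊆
      {g | t < ∑ j, g j * a j} ∪ {g | t < ∑ j, g j * (- a j)} := by
    intro g hg
    simpa [lt_abs] using hg
  refine (measureReal_mono this).trans ((measureReal_union_le _ _).trans ?_)
  linarith

lemma stdRow_tail_ge {m : ℕ} (a : Fin m → ℝ) {s v : ℝ} (hs : 0 ≤ s) (hv : 0 < v)
    (ha : ∑ j, a j ^ 2 = v) :
    (1 / 3) * Real.exp (-(s / √v + 1) ^ 2 / 2) ≤ (stdRow m).real {g | s < ∑ j, g j * a j} := by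
  have h := gaussianReal_Ioi_ge (t := s / √v) (by positivity)
  have hv' : 0 < √v := Real.sqrt_pos.2 hv
  have h1 : ∑ j, (a j / √v) ^ 2 = 1 := by
    simp_rw [div_pow, ← Finset.sum_div, Real.sq_sqrt hv.le, ha]
    exact div_self hv.ne'
  have h2 := map_linear_stdRow (fun j => a j / √v)
  rw [h1, Real.toNNReal_one] at h2
  rw [← h2, map_measureReal_apply (measurable_linear _) measurableSet_Ioi] at h
  convert h using 3
  ext g
  simp only [Set.mem_preimage, Set.mem_Ioi, Set.mem_ofPred_eq, ← mul_div_assoc, ← Finset.sum_div]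
  rw [div_lt_div_iff_of_pos_right hv']

lemma stdRow_joint_tail_le {m : ℕ} (v w : Fin m → ℝ) {t κ : ℝ} (ht : 0 ≤ t) (hκ : 0 < κ)
    (hv : ∑ j, v j ^ 2 = 1) (hw : ∑ j, w j ^ 2 = 1) (hr : 1 + ∑ j, v j * w j ≤ κ) :
    (stdRow m).real {g | t < ∑ j, g j * v j ∧ t < ∑ j, g j * w j} ≤ Real.exp (-t ^ 2 / κ) := by
  have h := stdRow_tail_le (fun j => v j + w j) (t := 2 * t) (σ := 2 * κ) (by positivity)
    (by positivity) (by
      have : ∑ j, (v j + w j) ^ 2 = ∑ j, v j ^ 2 + 2 * ∑ j, v j * w j + ∑ j, w j ^ 2 := by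
        rw [Finset.mul_sum, ← Finset.sum_add_distrib, ← Finset.sum_add_distrib]
        exact Finset.sum_congr rfl fun i _ => by ring
      rw [this]; linarith)
  have e : -(2 * t) ^ 2 / (2 * (2 * κ)) = -t ^ 2 / κ := by field_simp
  rw [e] at h
  refine (measureReal_mono ?_).trans h
  intro g hg
  simp only [Set.mem_ofPred_eq, mul_add, Finset.sum_add_distrib] at hg ⊢
  linarith [hg.1, hg.2]

lemma stdRow_joint_tail_ge {m : ℕ} (v w : Fin m → ℝ) {t κ : ℝ} (ht : 0 ≤ t) (hκ : 0 < κ)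
    (hv : ∑ j, v j ^ 2 = 1) (hw : ∑ j, w j ^ 2 = 1) (hr : κ ≤ 1 + ∑ j, v j * w j) :
    (1 / 6) * Real.exp (-(t + 3) ^ 2 / κ) ≤
      (stdRow m).real {g | t < ∑ j, g j * v j ∧ t < ∑ j, g j * w j} := by
  set r := ∑ j, v j * w j with hrdef
  have hp : ∑ j, (v j + w j) ^ 2 = 2 * (1 + r) := by
    have : ∑ j, (v j + w j) ^ 2 = ∑ j, v j ^ 2 + 2 * ∑ j, v j * w j + ∑ j, w j ^ 2 := by
      rw [Finset.mul_sum, ← Finset.sum_add_distrib, ← Finset.sum_add_distrib]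
      exact Finset.sum_congr rfl fun i _ => by ring
    rw [this]; linarith
  have hm : ∑ j, (v j - w j) ^ 2 = 2 * (1 - r) := by
    have : ∑ j, (v j - w j) ^ 2 = ∑ j, v j ^ 2 - 2 * ∑ j, v j * w j + ∑ j, w j ^ 2 := by
      rw [Finset.mul_sum, ← Finset.sum_sub_distrib, ← Finset.sum_add_distrib]
      exact Finset.sum_congr rfl fun i _ => by ring
    rw [this]; linarith
  have hr1 : r ≤ 1 := by
    have : 0 ≤ ∑ j, (v j - w j) ^ 2 := Finset.sum_nonneg fun i _ => sq_nonneg _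
    linarith
  have horth : ∑ j, (v j + w j) * (v j - w j) = 0 := by
    have : ∑ j, (v j + w j) * (v j - w j) = ∑ j, v j ^ 2 - ∑ j, w j ^ 2 := by
      rw [← Finset.sum_sub_distrib]
      exact Finset.sum_congr rfl fun i _ => by ring
    rw [this]; linarith
  have hind := indepFun_linear_stdRow (fun j => v j + w j) (fun j => v j - w j) horth
  have hS := stdRow_tail_ge (fun j => v j + w j) (s := 2 * t + 4) (v := 2 * (1 + r)) (by positivity)
    (by linarith) hp
  have hD := stdRow_abs_tail_le (fun j => v j - w j) (t := 4) (σ := 4) (by norm_num) (by norm_num)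
    (by rw [hm]; linarith)
  have hD' : (1 / 2 : ℝ) ≤ (stdRow m).real {g | |∑ j, g j * (v j - w j)| ≤ 4} := by
    have hc : {g : Fin m → ℝ | |∑ j, g j * (v j - w j)| ≤ 4} =
        {g | 4 < |∑ j, g j * (v j - w j)|}ᶜ := by
      ext g; simp
    rw [hc, probReal_compl_eq_one_sub (measurableSet_lt (by fun_prop) (by fun_prop))]
    have : Real.exp (-4 ^ 2 / (2 * 4)) ≤ 1 / 4 := by
      have h1 : Real.exp (-4 ^ 2 / (2 * 4)) = (Real.exp 1)⁻¹ ^ 2 := by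
        rw [← Real.exp_neg, ← Real.exp_nat_mul]; norm_num
      have h2 : (Real.exp 1)⁻¹ ≤ 1 / 2 := by
        rw [one_div]; exact inv_anti₀ (by norm_num) (by linarith [Real.exp_one_gt_d9])
      rw [h1]
      have h3 : 0 < (Real.exp 1)⁻¹ := by positivity
      nlinarith
    linarith
  have hprod := hind.measure_inter_preimage_eq_mul (Set.Ioi (2 * t + 4)) (Set.Icc (-4) 4)
    measurableSet_Ioi measurableSet_Icc
  have hprod' : (stdRow m).real {g | 2 * t + 4 < ∑ j, g j * (v j + w j) ∧
      |∑ j, g j * (v j - w j)| ≤ 4} = (stdRow m).real {g | 2 * t + 4 < ∑ j, g j * (v j + w j)} *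
      (stdRow m).real {g | |∑ j, g j * (v j - w j)| ≤ 4} := by
    simp only [measureReal_def, ← ENNReal.toReal_mul, abs_le]
    exact congrArg ENNReal.toReal hprod
  calc (1 / 6) * Real.exp (-(t + 3) ^ 2 / κ)
      ≤ (1 / 3 * Real.exp (-((2 * t + 4) / √(2 * (1 + r)) + 1) ^ 2 / 2)) * (1 / 2) := by
        have : Real.exp (-(t + 3) ^ 2 / κ) ≤
            Real.exp (-((2 * t + 4) / √(2 * (1 + r)) + 1) ^ 2 / 2) := by
          apply Real.exp_le_exp.2
          have hpos : 0 < 2 * (1 + r) := by linarith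
          have hq : 0 < √(2 * (1 + r)) := Real.sqrt_pos.2 hpos
          have hq2 : √(2 * (1 + r)) ≤ 2 := by
            rw [Real.sqrt_le_left (by norm_num)]; linarith
          have h1 : (2 * t + 4) / √(2 * (1 + r)) + 1 ≤ (2 * t + 6) / √(2 * (1 + r)) := by
            rw [div_add_one hq.ne']
            exact div_le_div_of_nonneg_right (by linarith) hq.le
          have h2 : ((2 * t + 4) / √(2 * (1 + r)) + 1) ^ 2 ≤ ((2 * t + 6) / √(2 * (1 + r))) ^ 2 := by
            gcongr
          have h3 : ((2 * t + 6) / √(2 * (1 + r))) ^ 2 = 2 * ((t + 3) ^ 2 / (1 + r)) := by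
            rw [div_pow, Real.sq_sqrt hpos.le]; field_simp; ring
          have h4 : (t + 3) ^ 2 / (1 + r) ≤ (t + 3) ^ 2 / κ := by gcongr
          rw [neg_div, neg_div]
          linarith
        linarith
    _ ≤ (stdRow m).real {g | 2 * t + 4 < ∑ j, g j * (v j + w j)} *
      (stdRow m).real {g | |∑ j, g j * (v j - w j)| ≤ 4} := by gcongr
    _ ≤ _ := by
      rw [← hprod']
      refine measureReal_mono ?_
      rintro g ⟨h1, h2⟩
      simp only [mul_add, mul_sub, Finset.sum_add_distrib, Finset.sum_sub_distrib, abs_le] at h1 h2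
      simp only [Set.mem_ofPred_eq]
      constructor <;> linarith [h2.1, h2.2]

instance (k m : ℕ) : IsProbabilityMeasure (gaussMatrix k m) := by
  unfold gaussMatrix; infer_instance

lemma gaussMatrix_pi (k m : ℕ) (s : Fin k → Set (Fin m → ℝ)) :
    (gaussMatrix k m).real (Set.univ.pi s) = ∏ i, (stdRow m).real (s i) := by
  simp only [gaussMatrix, measureReal_def, Measure.pi_pi, ENNReal.toReal_prod]

lemma gaussMatrix_eval (k m : ℕ) (i : Fin k) {s : Set (Fin m → ℝ)} (hs : MeasurableSet s) :
    (gaussMatrix k m).real {A | A i ∈ s} = (stdRow m).real s := by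
  have := (measurePreserving_eval (fun _ : Fin k => stdRow m) i).measureReal_preimage
    hs.nullMeasurableSet
  exact this

lemma gaussMatrix_all_le {N m : ℕ} (v : Fin m → ℝ) (hv : ∑ j, v j ^ 2 = 1) {t : ℝ} (ht : 0 ≤ t) :
    (gaussMatrix N m).real {A | ∀ i, |mvMul A v i| ≤ t} ≤
      Real.exp (-(N / 3 * Real.exp (-(t + 1) ^ 2 / 2))) := by
  have e : {A : Fin N → Fin m → ℝ | ∀ i, |mvMul A v i| ≤ t} =
      Set.univ.pi fun _ => {g | |∑ j, g j * v j| ≤ t} := by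
    ext A; simp [mvMul]
  rw [e, gaussMatrix_pi, Finset.prod_const, Finset.card_univ, Fintype.card_fin]
  have h1 := stdRow_tail_ge v ht one_pos hv
  rw [Real.sqrt_one, div_one] at h1
  have h2 : (stdRow m).real {g | |∑ j, g j * v j| ≤ t} ≤
      1 - 1 / 3 * Real.exp (-(t + 1) ^ 2 / 2) := by
    have : (stdRow m).real {g | |∑ j, g j * v j| ≤ t} ≤
        (stdRow m).real {g | t < ∑ j, g j * v j}ᶜ := measureReal_mono fun g hg => by
      simp only [Set.mem_ofPred_eq, Set.mem_compl_iff, not_lt] at hg ⊢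
      exact (le_abs_self _).trans hg
    rw [probReal_compl_eq_one_sub (measurableSet_lt (by fun_prop) (by fun_prop))] at this
    linarith
  have h3 := h2.trans (Real.one_sub_le_exp_neg _)
  refine (pow_le_pow_left₀ measureReal_nonneg h3 N).trans_eq ?_
  rw [← Real.exp_nat_mul]
  congr 1; ring

lemma gaussMatrix_collide_le {N m : ℕ} (hN : 2 ≤ N) (v w : Fin m → ℝ) {t κ : ℝ} (ht : 0 ≤ t)
    (hκ : 0 < κ) (hv : ∑ j, v j ^ 2 = 1) (hw : ∑ j, w j ^ 2 = 1)
    (hr : 1 + ∑ j, v j * w j ≤ κ) :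
    (gaussMatrix N m).real {A | collide A v w} ≤ 2 * N * Real.exp (-t ^ 2 / κ) +
      2 * Real.exp (-(N / 3 * Real.exp (-(t + 1) ^ 2 / 2))) := by
  set P : Set (Fin m → ℝ) := {g | t < ∑ j, g j * v j ∧ t < ∑ j, g j * w j} with hP
  set Q : Set (Fin m → ℝ) := {g | t < ∑ j, g j * (-v j) ∧ t < ∑ j, g j * (-w j)} with hQ
  have hPm : MeasurableSet P :=
    (measurableSet_lt measurable_const (measurable_linear v)).inter
      (measurableSet_lt measurable_const (measurable_linear w))
  have hQm : MeasurableSet Q :=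
    (measurableSet_lt measurable_const (measurable_linear fun j => -v j)).inter
      (measurableSet_lt measurable_const (measurable_linear fun j => -w j))
  have hPt := stdRow_joint_tail_le v w ht hκ hv hw hr
  have hQt := stdRow_joint_tail_le (fun j => -v j) (fun j => -w j) ht hκ (by simpa) (by simpa)
    (by simpa)
  have hsub : {A : Fin N → Fin m → ℝ | collide A v w} ⊆
      ((⋃ i, {A | A i ∈ P}) ∪ (⋃ i, {A | A i ∈ Q})) ∪
      ({A | ∀ i, |mvMul A v i| ≤ t} ∪ {A | ∀ i, |mvMul A w i| ≤ t}) := by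
    rintro A ⟨i, s, hs, h1, h2⟩
    by_contra hcon
    simp only [Set.mem_union, Set.mem_iUnion, Set.mem_ofPred_eq, not_or, not_exists, not_forall,
      not_le] at hcon
    obtain ⟨⟨hnP, hnQ⟩, ⟨j, hj⟩, ⟨k, hk⟩⟩ := hcon
    have : Nontrivial (Fin N) := Fin.nontrivial_iff_two_le.2 hN
    obtain ⟨l, hl⟩ := exists_ne i
    have key : ∀ u : Fin m → ℝ, hashAt A u i s → (∃ j, t < |mvMul A u j|) →
        t < s * mvMul A u i := by
      rintro u hu ⟨j, hj⟩
      by_cases hji : j = i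
      · subst hji
        have h0 := (abs_nonneg _).trans_lt (hu l hl)
        have : |mvMul A u j| = s * mvMul A u j := by
          rw [← abs_of_pos h0, abs_mul]
          rcases hs with rfl | rfl <;> simp
        linarith
      · exact hj.trans (hu j hji)
    have h1' := key v h1 ⟨j, hj⟩
    have h2' := key w h2 ⟨k, hk⟩
    rcases hs with rfl | rfl
    · exact hnP i ⟨by simpa [mvMul] using h1', by simpa [mvMul] using h2'⟩
    · exact hnQ i ⟨by simpa [mvMul] using h1', by simpa [mvMul] using h2'⟩
  have hu : ∀ S : Set (Fin m → ℝ), MeasurableSet S → (stdRow m).real S ≤ Real.exp (-t ^ 2 / κ) →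
      (gaussMatrix N m).real (⋃ i, {A | A i ∈ S}) ≤ N * Real.exp (-t ^ 2 / κ) := by
    intro S hS hle
    refine (measureReal_iUnion_fintype_le _).trans ?_
    simp_rw [gaussMatrix_eval N m _ hS]
    rw [Finset.sum_const, Finset.card_univ, Fintype.card_fin, nsmul_eq_mul]
    gcongr
  have e1 := hu P hPm hPt
  have e2 := hu Q hQm hQt
  have e3 := gaussMatrix_all_le (N := N) v hv ht
  have e4 := gaussMatrix_all_le (N := N) w hw ht
  refine (measureReal_mono hsub).trans ((measureReal_union_le _ _).trans ?_)
  have e5 := measureReal_union_le (μ := gaussMatrix N m) (⋃ i, {A | A i ∈ P}) (⋃ i, {A | A i ∈ Q})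
  have e6 := measureReal_union_le (μ := gaussMatrix N m)
    {A : Fin N → Fin m → ℝ | ∀ i, |mvMul A v i| ≤ t} {A | ∀ i, |mvMul A w i| ≤ t}
  linarith

lemma gaussMatrix_collide_ge {N m : ℕ} (v w : Fin m → ℝ) {t κ : ℝ} (ht : 0 ≤ t)
    (hκ : 0 < κ) (hv : ∑ j, v j ^ 2 = 1) (hw : ∑ j, w j ^ 2 = 1)
    (hr : κ ≤ 1 + ∑ j, v j * w j) (hN : 4 * N * Real.exp (-t ^ 2 / 2) ≤ 1 / 2) :
    N / 12 * Real.exp (-(t + 3) ^ 2 / κ) ≤ (gaussMatrix N m).real {A | collide A v w} := by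
  set P : Set (Fin m → ℝ) := {g | t < ∑ j, g j * v j ∧ t < ∑ j, g j * w j} with hP
  set Q : Set (Fin m → ℝ) := {g | |∑ j, g j * v j| ≤ t ∧ |∑ j, g j * w j| ≤ t} with hQ
  have hPm : MeasurableSet P :=
    (measurableSet_lt measurable_const (measurable_linear v)).inter
      (measurableSet_lt measurable_const (measurable_linear w))
  have hQm : MeasurableSet Q :=
    (measurableSet_le (measurable_linear v).abs measurable_const).inter
      (measurableSet_le (measurable_linear w).abs measurable_const)
  have hPt := stdRow_joint_tail_ge v w ht hκ hv hw hr
  set ε := Real.exp (-t ^ 2 / 2) with hε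
  have hε0 : 0 < ε := Real.exp_pos _
  have hQt : 1 - 4 * ε ≤ (stdRow m).real Q := by
    have h1 := stdRow_abs_tail_le v ht one_pos hv.le
    have h2 := stdRow_abs_tail_le w ht one_pos hw.le
    rw [mul_one] at h1 h2
    have h3 : (stdRow m).real Qᶜ ≤ 4 * ε := by
      have : Qᶜ ⊆ {g | t < |∑ j, g j * v j|} ∪ {g | t < |∑ j, g j * w j|} := by
        intro g hg
        simp only [hQ, Set.mem_compl_iff, Set.mem_ofPred_eq, not_and_or, not_le] at hg
        exact hg
      refine (measureReal_mono this).trans ((measureReal_union_le _ _).trans ?_)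
      linarith
    rw [probReal_compl_eq_one_sub hQm] at h3
    linarith
  let E : Fin N → Set (Fin N → Fin m → ℝ) := fun i =>
    Set.univ.pi fun j => if j = i then P else Q
  have hEsub : (⋃ i, E i) ⊆ {A | collide A v w} := by
    intro A hA
    obtain ⟨i, hi⟩ := Set.mem_iUnion.1 hA
    simp only [E, Set.mem_univ_pi] at hi
    have hii := hi i
    simp only [if_true, hP, Set.mem_ofPred_eq] at hii
    refine ⟨i, 1, Or.inl rfl, fun j hj => ?_, fun j hj => ?_⟩
    · have := hi j
      rw [if_neg hj] at this
      rw [one_mul]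
      exact lt_of_le_of_lt this.1 hii.1
    · have := hi j
      rw [if_neg hj] at this
      rw [one_mul]
      exact lt_of_le_of_lt this.2 hii.2
  have hdisj : Pairwise (Function.onFun Disjoint E) := by
    intro i j hij
    rw [Function.onFun, Set.disjoint_left]
    intro A hi hj
    simp only [E, Set.mem_univ_pi] at hi hj
    have h1 := hi i
    have h2 := hj i
    rw [if_pos rfl] at h1
    rw [if_neg hij] at h2
    exact absurd ((le_abs_self _).trans h2.1) (not_le.2 h1.1)
  have hmeas : ∀ i, MeasurableSet (E i) := fun i =>
    MeasurableSet.univ_pi fun j => by split_ifs <;> assumption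
  have hE : ∀ i, 1 / 12 * Real.exp (-(t + 3) ^ 2 / κ) ≤ (gaussMatrix N m).real (E i) := by
    intro i
    rw [gaussMatrix_pi, ← Finset.mul_prod_erase _ _ (Finset.mem_univ i), if_pos rfl]
    have : ∏ x ∈ Finset.univ.erase i, (stdRow m).real (if x = i then P else Q) =
        (stdRow m).real Q ^ (N - 1) := by
      rw [Finset.prod_congr rfl (g := fun _ => (stdRow m).real Q)]
      · simp
      · intro x hx
        rw [if_neg (Finset.ne_of_mem_erase hx)]
    rw [this]
    have hNpos : 1 ≤ N := by have := i.2; omega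
    have hNr : (1 : ℝ) ≤ N := by exact_mod_cast hNpos
    have h4ε : 4 * ε ≤ 1 / 2 := by nlinarith
    have hpow : (1 / 2 : ℝ) ≤ (stdRow m).real Q ^ (N - 1) := by
      have hb := one_add_mul_le_pow (a := -(4 * ε)) (by linarith) (N - 1)
      have hc : (1 + -(4 * ε)) ^ (N - 1) ≤ (stdRow m).real Q ^ (N - 1) :=
        pow_le_pow_left₀ (by linarith) (by linarith) _
      have hd : ((N - 1 : ℕ) : ℝ) ≤ N := by exact_mod_cast Nat.sub_le _ _
      nlinarith
    have := mul_le_mul hPt hpow (by norm_num) measureReal_nonneg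
    linarith
  calc N / 12 * Real.exp (-(t + 3) ^ 2 / κ)
      = ∑ i : Fin N, 1 / 12 * Real.exp (-(t + 3) ^ 2 / κ) := by
        rw [Finset.sum_const, Finset.card_univ, Fintype.card_fin, nsmul_eq_mul]; ring
    _ ≤ ∑ i, (gaussMatrix N m).real (E i) := Finset.sum_le_sum fun i _ => hE i
    _ = (gaussMatrix N m).real (⋃ i, E i) := by
        rw [measureReal_iUnion_fintype hdisj hmeas]
    _ ≤ _ := measureReal_mono hEsub

lemma mvMul_mul {k m : ℕ} (A : Fin k → Fin m → ℝ) (a : ℝ) (v : Fin m → ℝ) (i : Fin k) :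
    mvMul A (fun j => a * v j) i = a * mvMul A v i := by
  simp only [mvMul, Finset.mul_sum]
  exact Finset.sum_congr rfl fun j _ => by ring

lemma hashAt_mul {k m : ℕ} (A : Fin k → Fin m → ℝ) {a : ℝ} (ha : 0 < a) (v : Fin m → ℝ)
    (i : Fin k) (s : ℝ) : hashAt A (fun j => a * v j) i s ↔ hashAt A v i s := by
  simp only [hashAt, mvMul_mul, abs_mul, abs_of_pos ha]
  refine forall₂_congr fun j _ => ?_
  rw [mul_left_comm, mul_lt_mul_iff_right₀ ha]

lemma collide_mul {k m : ℕ} (A : Fin k → Fin m → ℝ) {a b : ℝ} (ha : 0 < a) (hb : 0 < b)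
    (v w : Fin m → ℝ) : collide A (fun j => a * v j) (fun j => b * w j) ↔ collide A v w := by
  simp only [collide, hashAt_mul A ha, hashAt_mul A hb]

/-- The exponent bound behind the upper estimate, with `L = ln N` and `t = √(2(1-η)L)`. -/
lemma exists_upper_rate {κ δ : ℝ} (hκ : 0 < κ) (hδ : 0 < δ) :
    ∃ η > 0, η < κ ∧ η < 1 ∧ ∀ᶠ L : ℝ in atTop,
      2 * Real.exp L * Real.exp (-√(2 * (1 - η) * L) ^ 2 / (κ + η)) +
        2 * Real.exp (-(Real.exp L / 3 * Real.exp (-(√(2 * (1 - η) * L) + 1) ^ 2 / 2))) ≤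
      Real.exp (-(2 / κ - 1 - δ) * L) := by
  have hc : Tendsto (fun η : ℝ => 2 * (1 - η) / (κ + η)) (nhdsWithin 0 (Set.Ioi 0))
      (nhds (2 / κ)) := by
    have : ContinuousAt (fun η : ℝ => 2 * (1 - η) / (κ + η)) 0 := by
      refine ContinuousAt.div (by fun_prop) (by fun_prop) (by simpa using hκ.ne')
    have h := this.tendsto.mono_left (nhdsWithin_le_nhds (s := Set.Ioi 0))
    simpa using h
  have h1 := hc.eventually (lt_mem_nhds (show 2 / κ - δ / 2 < 2 / κ by linarith))
  have h2 : ∀ᶠ η : ℝ in nhdsWithin 0 (Set.Ioi 0), η < κ ∧ η < 1 :=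
    nhdsWithin_le_nhds ((gt_mem_nhds hκ).and (gt_mem_nhds one_pos))
  obtain ⟨η, hη, ⟨hηκ, hη1⟩, hη0⟩ := (h1.and (h2.and self_mem_nhdsWithin)).exists
  refine ⟨η, hη0, hηκ, hη1, ?_⟩
  have ht : Tendsto (fun L : ℝ => √(2 * (1 - η) * L)) atTop atTop :=
    Real.tendsto_sqrt_atTop.comp (tendsto_id.const_mul_atTop (by linarith))
  have hlin : Tendsto (fun L : ℝ => Real.exp (η / 2 * L) / (L ^ (1 : ℝ))) atTop atTop := by
    have h := tendsto_exp_mul_div_rpow_atTop 1 (η / 2) (by positivity)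
    exact h
  filter_upwards [ht.eventually_ge_atTop (8 / η + 1), eventually_ge_atTop (8 / δ + 2),
    hlin.eventually_ge_atTop (3 * (|2 / κ - 1 - δ| + 2)), eventually_gt_atTop 0]
    with L hL1 hL2 hL3 hL0
  set t := √(2 * (1 - η) * L) with htdef
  have ht2 : t ^ 2 = 2 * (1 - η) * L := Real.sq_sqrt (by nlinarith)
  rw [ht2]
  have hlog4 : (4 : ℝ) ≤ Real.exp 2 := by
    have : Real.exp 2 = Real.exp 1 ^ 2 := by rw [← Real.exp_nat_mul]; norm_num
    rw [this]; nlinarith [Real.exp_one_gt_d9]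
  have hA : 2 * Real.exp L * Real.exp (-(2 * (1 - η) * L) / (κ + η)) ≤
      1 / 2 * Real.exp (-(2 / κ - 1 - δ) * L) := by
    have h3 : L + -(2 * (1 - η) * L) / (κ + η) + 2 ≤ -(2 / κ - 1 - δ) * L := by
      have e : -(2 * (1 - η) * L) / (κ + η) = -(2 * (1 - η) / (κ + η)) * L := by ring
      have h4 : 2 ≤ δ / 2 * L := by
        have : δ * (8 / δ) = 8 := by field_simp
        nlinarith
      rw [e]; nlinarith
    have h5 := Real.exp_le_exp.2 h3
    rw [Real.exp_add, Real.exp_add] at h5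
    have h6 : 0 < Real.exp L * Real.exp (-(2 * (1 - η) * L) / (κ + η)) := by positivity
    nlinarith
  have hB : 2 * Real.exp (-(Real.exp L / 3 * Real.exp (-(t + 1) ^ 2 / 2))) ≤
      1 / 2 * Real.exp (-(2 / κ - 1 - δ) * L) := by
    have h8 : η * (8 / η) = 8 := by field_simp
    have h9 : 8 / η > 0 := by positivity
    have h3 : (t + 1) ^ 2 / 2 ≤ (1 - η / 2) * L := by
      have h10 : 8 ≤ η * t := by nlinarith
      have h12 : 1 ≤ t := by linarith
      have h11 : (t + 1) ^ 2 ≤ (1 + η / 2) * t ^ 2 := by nlinarith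
      rw [ht2] at h11
      nlinarith [mul_pos (mul_pos hη0 hη0) hL0]
    have h4 : Real.exp (η / 2 * L) ≤ Real.exp L * Real.exp (-(t + 1) ^ 2 / 2) := by
      rw [← Real.exp_add]
      apply Real.exp_le_exp.2
      rw [neg_div]; linarith
    rw [Real.rpow_one, le_div_iff₀ hL0] at hL3
    have h5 : 2 + (2 / κ - 1 - δ) * L ≤ Real.exp L / 3 * Real.exp (-(t + 1) ^ 2 / 2) := by
      have hL1 : 1 ≤ L := by
        have : 0 < 8 / δ := by positivity
        linarith
      nlinarith [le_abs_self (2 / κ - 1 - δ)]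
    have h6 : -(Real.exp L / 3 * Real.exp (-(t + 1) ^ 2 / 2)) + 2 ≤ -(2 / κ - 1 - δ) * L := by
      linarith
    have h7 := Real.exp_le_exp.2 h6
    rw [Real.exp_add] at h7
    have h8 := Real.exp_pos (-(Real.exp L / 3 * Real.exp (-(t + 1) ^ 2 / 2)))
    nlinarith
  linarith

/-- The exponent bound behind the lower estimate, with `L = ln N` and `t = √(2(1+η)L)`. -/
lemma exists_lower_rate {κ δ : ℝ} (hκ : 0 < κ) (hδ : 0 < δ) :
    ∃ η > 0, η < κ ∧ ∀ᶠ L : ℝ in atTop,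
      4 * Real.exp L * Real.exp (-√(2 * (1 + η) * L) ^ 2 / 2) ≤ 1 / 2 ∧
      Real.exp (-(2 / κ - 1 + δ) * L) ≤
        Real.exp L / 12 * Real.exp (-(√(2 * (1 + η) * L) + 3) ^ 2 / (κ - η)) := by
  have hc : Tendsto (fun η : ℝ => 2 * (1 + η) ^ 2 / (κ - η)) (nhdsWithin 0 (Set.Ioi 0))
      (nhds (2 / κ)) := by
    have : ContinuousAt (fun η : ℝ => 2 * (1 + η) ^ 2 / (κ - η)) 0 := by
      refine ContinuousAt.div (by fun_prop) (by fun_prop) (by simpa using hκ.ne')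
    have h := this.tendsto.mono_left (nhdsWithin_le_nhds (s := Set.Ioi 0))
    simpa using h
  have h1 := hc.eventually (gt_mem_nhds (show 2 / κ < 2 / κ + δ / 2 by linarith))
  have h2 : ∀ᶠ η : ℝ in nhdsWithin 0 (Set.Ioi 0), η < κ ∧ η < 1 :=
    nhdsWithin_le_nhds ((gt_mem_nhds hκ).and (gt_mem_nhds one_pos))
  obtain ⟨η, hη, ⟨hηκ, hη1⟩, hη0⟩ := (h1.and (h2.and self_mem_nhdsWithin)).exists
  refine ⟨η, hη0, hηκ, ?_⟩
  have ht : Tendsto (fun L : ℝ => √(2 * (1 + η) * L)) atTop atTop :=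
    Real.tendsto_sqrt_atTop.comp (tendsto_id.const_mul_atTop (by linarith))
  filter_upwards [ht.eventually_ge_atTop (16 / η + 1), eventually_ge_atTop (8 / δ),
    eventually_ge_atTop (4 / η), eventually_gt_atTop 0] with L hL1 hL2 hL3 hL0
  set t := √(2 * (1 + η) * L) with htdef
  have ht2 : t ^ 2 = 2 * (1 + η) * L := Real.sq_sqrt (by positivity)
  have he : (2.7 : ℝ) < Real.exp 1 := by linarith [Real.exp_one_gt_d9]
  constructor
  · rw [ht2, mul_assoc, ← Real.exp_add]
    have : L + -(2 * (1 + η) * L) / 2 ≤ -4 := by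
      have : η * (4 / η) = 4 := by field_simp
      nlinarith
    have h3 := Real.exp_le_exp.2 this
    have h4 : Real.exp (-4) = (Real.exp 1)⁻¹ ^ 4 := by
      rw [← Real.exp_neg, ← Real.exp_nat_mul]; norm_num
    have h5 : (Real.exp 1)⁻¹ ≤ 1 / 2 := by
      rw [one_div]; exact inv_anti₀ (by norm_num) (by linarith)
    have h6 : (Real.exp 1)⁻¹ ^ 4 ≤ (1 / 2) ^ 4 := by gcongr
    rw [h4] at h3
    linarith
  · have h8 : η * (16 / η) = 16 := by field_simp
    have h9 : 16 / η > 0 := by positivity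
    have h10 : 16 ≤ η * t := by nlinarith
    have h12 : 1 ≤ t := by linarith
    have h11 : (t + 3) ^ 2 ≤ (1 + η) * t ^ 2 := by nlinarith
    rw [ht2] at h11
    have h13 : (t + 3) ^ 2 / (κ - η) ≤ (2 * (1 + η) ^ 2 / (κ - η)) * L := by
      rw [div_mul_eq_mul_div]
      exact div_le_div_of_nonneg_right (by linarith) (by linarith)
    have h14 : 4 ≤ δ / 2 * L := by
      have : δ * (8 / δ) = 8 := by field_simp
      nlinarith
    have h15 : -(2 / κ - 1 + δ) * L + 4 ≤ L + -(t + 3) ^ 2 / (κ - η) := by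
      rw [neg_div]; nlinarith
    have h16 := Real.exp_le_exp.2 h15
    rw [Real.exp_add, Real.exp_add L] at h16
    have h17 : (12 : ℝ) ≤ Real.exp 4 := by
      have : Real.exp 4 = Real.exp 1 ^ 4 := by rw [← Real.exp_nat_mul]; norm_num
      rw [this]
      have : (2 : ℝ) ^ 4 ≤ Real.exp 1 ^ 4 := by gcongr; linarith
      linarith
    have h18 := Real.exp_pos (-(2 / κ - 1 + δ) * L)
    nlinarith

/-- Collision exponent of the Gaussian cross-polytope hash for vectors that are approximately unit
with `‖v + w‖² ≈ 2κ`. -/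
lemma gaussMatrix_collide_exponent {κ δ : ℝ} (hκ : 0 < κ) (hδ : 0 < δ) :
    ∃ ε > 0, ∀ᶠ N : ℕ in atTop, ∀ (m : ℕ) (v w : Fin m → ℝ),
      |∑ j, v j ^ 2 - 1| < ε → |∑ j, w j ^ 2 - 1| < ε →
      |∑ j, (v j + w j) ^ 2 - 2 * κ| < ε →
      Real.exp (-(2 / κ - 1 + δ) * Real.log N) ≤ (gaussMatrix N m).real {A | collide A v w} ∧
      (gaussMatrix N m).real {A | collide A v w} ≤
        Real.exp (-(2 / κ - 1 - δ) * Real.log N) := by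
  obtain ⟨η₁, h1pos, h1κ, h11, hup⟩ := exists_upper_rate hκ hδ
  obtain ⟨η₂, h2pos, h2κ, hlo⟩ := exists_lower_rate hκ hδ
  have hcont : ContinuousAt (fun p : ℝ × ℝ × ℝ => 1 + (p.2.2 - p.1 - p.2.1) / 2 *
      ((√p.1)⁻¹ * (√p.2.1)⁻¹)) (1, 1, 2 * κ) := by
    have : ∀ f : ℝ × ℝ × ℝ → ℝ, Continuous f → f (1, 1, 2 * κ) = 1 →
        ContinuousAt (fun p => (√(f p))⁻¹) (1, 1, 2 * κ) := fun f hf h =>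
      ContinuousAt.inv₀ (by fun_prop) (by simp [h])
    have e1 := this (fun p => p.1) (by fun_prop) rfl
    have e2 := this (fun p => p.2.1) (by fun_prop) rfl
    exact continuousAt_const.add (ContinuousAt.mul (by fun_prop) (e1.mul e2))
  have hmem := Metric.continuousAt_iff.1 hcont (min η₁ η₂) (lt_min h1pos h2pos)
  obtain ⟨ε, hε, hball⟩ := hmem
  refine ⟨min ε 1, lt_min hε one_pos, ?_⟩
  have hlog : Tendsto (fun N : ℕ => Real.log N) atTop atTop :=
    Real.tendsto_log_atTop.comp tendsto_natCast_atTop_atTop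
  filter_upwards [hlog.eventually hup, hlog.eventually hlo, eventually_ge_atTop 2] with
    N hNup hNlo hN2 m v w hv hw hvw
  have hNpos : (0 : ℝ) < N := by exact_mod_cast (by omega : 0 < N)
  rw [Real.exp_log hNpos] at hNup hNlo
  have hv1 := hv.trans_le (min_le_right ε 1)
  have hw1 := hw.trans_le (min_le_right ε 1)
  rw [abs_lt] at hv1 hw1
  have hb := @hball (∑ j, v j ^ 2, ∑ j, w j ^ 2, ∑ j, (v j + w j) ^ 2) (by
    simp only [Prod.dist_eq, Real.dist_eq, max_lt_iff]
    exact ⟨hv.trans_le (min_le_left _ _), hw.trans_le (min_le_left _ _),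
      hvw.trans_le (min_le_left _ _)⟩)
  have hvp : 0 < √(∑ j, v j ^ 2) := Real.sqrt_pos.2 (by linarith)
  have hwp : 0 < √(∑ j, w j ^ 2) := Real.sqrt_pos.2 (by linarith)
  set a := (√(∑ j, v j ^ 2))⁻¹ with ha
  set b := (√(∑ j, w j ^ 2))⁻¹ with hb'
  have hapos : 0 < a := inv_pos.2 hvp
  have hbpos : 0 < b := inv_pos.2 hwp
  have huv : ∑ j, (a * v j) ^ 2 = 1 := by
    simp_rw [mul_pow, ← Finset.mul_sum]
    rw [ha, inv_pow, Real.sq_sqrt (by linarith)]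
    exact inv_mul_cancel₀ (by linarith)
  have huw : ∑ j, (b * w j) ^ 2 = 1 := by
    simp_rw [mul_pow, ← Finset.mul_sum]
    rw [hb', inv_pow, Real.sq_sqrt (by linarith)]
    exact inv_mul_cancel₀ (by linarith)
  have hinner : 1 + (∑ j, (v j + w j) ^ 2 - ∑ j, v j ^ 2 - ∑ j, w j ^ 2) / 2 * (a * b) =
      1 + ∑ j, (a * v j) * (b * w j) := by
    have : ∑ j, (v j + w j) ^ 2 = ∑ j, v j ^ 2 + 2 * ∑ j, v j * w j + ∑ j, w j ^ 2 := by
      rw [Finset.mul_sum, ← Finset.sum_add_distrib, ← Finset.sum_add_distrib]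
      exact Finset.sum_congr rfl fun i _ => by ring
    rw [this]
    have e : ∑ j, (a * v j) * (b * w j) = (∑ j, v j * w j) * (a * b) := by
      rw [Finset.sum_mul]; exact Finset.sum_congr rfl fun i _ => by ring
    rw [e]; ring
  simp only [Real.dist_eq] at hb
  rw [hinner] at hb
  have hval : (1 : ℝ) + (2 * κ - 1 - 1) / 2 * ((√1)⁻¹ * (√1)⁻¹) = κ := by
    rw [Real.sqrt_one]; ring
  rw [hval, lt_min_iff, abs_lt, abs_lt] at hb
  have hset : {A : Fin N → Fin m → ℝ | collide A v w} =
      {A | collide A (fun j => a * v j) (fun j => b * w j)} := by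
    ext A; exact (collide_mul A hapos hbpos v w).symm
  rw [hset]
  constructor
  · refine hNlo.2.trans ?_
    exact gaussMatrix_collide_ge _ _ (Real.sqrt_nonneg _) (by linarith) huv huw (by linarith)
      hNlo.1
  · refine le_trans ?_ hNup
    exact gaussMatrix_collide_le hN2 _ _ (Real.sqrt_nonneg _) (by linarith) huv huw (by linarith)

lemma hadamardEntry_eq_prod (n : ℕ) (i j : Fin (2 ^ n)) :
    hadamardEntry n i j = ∏ k : Fin n, (-1 : ℝ) ^
      ((finFunctionFinEquiv.symm i k : ℕ) * (finFunctionFinEquiv.symm j k : ℕ)) := by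
  rw [hadamardEntry, Finset.sum_range, Finset.prod_pow_eq_pow_sum]
  simp [finFunctionFinEquiv, Nat.shiftRight_eq_div_pow]

lemma hadamard_orthogonal (n : ℕ) (j l : Fin (2 ^ n)) :
    ∑ i, hadamardEntry n i j * hadamardEntry n i l = if j = l then (2 : ℝ) ^ n else 0 := by
  have h : ∀ i, hadamardEntry n i j * hadamardEntry n i l = ∏ k : Fin n, (-1 : ℝ) ^
      ((finFunctionFinEquiv.symm i k : ℕ) * ((finFunctionFinEquiv.symm j k : ℕ) +
        (finFunctionFinEquiv.symm l k : ℕ))) := by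
    intro i
    rw [hadamardEntry_eq_prod, hadamardEntry_eq_prod, ← Finset.prod_mul_distrib]
    exact Finset.prod_congr rfl fun k _ => by rw [mul_add, pow_add]
  simp_rw [h]
  rw [Fintype.sum_equiv finFunctionFinEquiv.symm _ (fun f : Fin n → Fin 2 => ∏ k : Fin n,
    (-1 : ℝ) ^ ((f k : ℕ) * ((finFunctionFinEquiv.symm j k : ℕ) +
        (finFunctionFinEquiv.symm l k : ℕ)))) (fun i => rfl)]
  have hp := Finset.prod_univ_sum (fun _ : Fin n => (Finset.univ : Finset (Fin 2)))
    (fun k a => (-1 : ℝ) ^ ((a : ℕ) * ((finFunctionFinEquiv.symm j k : ℕ) +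
        (finFunctionFinEquiv.symm l k : ℕ))))
  rw [Fintype.piFinset_univ] at hp
  rw [← hp]
  simp only [Fin.sum_univ_two, Fin.val_zero, Fin.val_one, zero_mul, pow_zero, one_mul]
  split_ifs with hjl
  · subst hjl
    simp only [← two_mul, pow_mul]
    norm_num
  · have : ∃ k, finFunctionFinEquiv.symm j k ≠ finFunctionFinEquiv.symm l k := by
      by_contra hcon
      push Not at hcon
      exact hjl (finFunctionFinEquiv.symm.injective (funext hcon))
    obtain ⟨k, hk⟩ := this
    refine Finset.prod_eq_zero (Finset.mem_univ k) ?_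
    have : (finFunctionFinEquiv.symm j k : ℕ) + (finFunctionFinEquiv.symm l k : ℕ) = 1 := by
      have h1 := (finFunctionFinEquiv.symm j k).2
      have h2 := (finFunctionFinEquiv.symm l k).2
      have h3 := Fin.val_ne_of_ne hk
      omega
    rw [this]; norm_num

lemma signOf_sq (b : Bool) : signOf b ^ 2 = 1 := by cases b <;> simp [signOf]

lemma hadamardEntry_sq (n : ℕ) (i j : Fin (2 ^ n)) : hadamardEntry n i j ^ 2 = 1 := by
  rw [hadamardEntry, ← pow_mul, mul_comm, pow_mul]; norm_num

/-- The coordinate `(H D_b x)_i`. -/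
noncomputable def hadamardCoord (n : ℕ) (b : Fin (2 ^ n) → Bool) (x : Fin (2 ^ n) → ℝ)
    (i : Fin (2 ^ n)) : ℝ :=
  ∑ k, hadamardEntry n i k * signOf (b k) * x k

lemma sum_hadamardCoord_sq (n : ℕ) (b : Fin (2 ^ n) → Bool) (x : Fin (2 ^ n) → ℝ) :
    ∑ i, hadamardCoord n b x i ^ 2 = 2 ^ n * ∑ k, x k ^ 2 := by
  calc ∑ i, hadamardCoord n b x i ^ 2
      = ∑ i, ∑ k, ∑ l, (hadamardEntry n i k * hadamardEntry n i l) *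
          ((signOf (b k) * x k) * (signOf (b l) * x l)) := by
        refine Finset.sum_congr rfl fun i _ => ?_
        rw [sq, hadamardCoord, Finset.sum_mul_sum]
        exact Finset.sum_congr rfl fun k _ => Finset.sum_congr rfl fun l _ => by ring
    _ = ∑ k, ∑ l, (∑ i, hadamardEntry n i k * hadamardEntry n i l) *
          ((signOf (b k) * x k) * (signOf (b l) * x l)) := by
        rw [Finset.sum_comm]
        refine Finset.sum_congr rfl fun k _ => ?_
        rw [Finset.sum_comm]
        exact Finset.sum_congr rfl fun l _ => by rw [Finset.sum_mul]
    _ = 2 ^ n * ∑ k, x k ^ 2 := by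
        simp_rw [hadamard_orthogonal, ite_mul, zero_mul, Finset.sum_ite_eq, Finset.mem_univ,
          if_true]
        rw [Finset.mul_sum]
        refine Finset.sum_congr rfl fun k _ => ?_
        have := signOf_sq (b k)
        linear_combination (2 ^ n * x k ^ 2) * this

open scoped Classical in
/-- Exponential Markov inequality for counting. -/
lemma card_filter_le_exp {α : Type*} [Fintype α] (f : α → ℝ) (T l : ℝ) (hl : 0 ≤ l) :
    ((Finset.univ.filter fun a => T ≤ f a).card : ℝ) ≤
      Real.exp (-(l * T)) * ∑ a, Real.exp (l * f a) := by
  rw [Finset.card_filter, Nat.cast_sum, Finset.mul_sum]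
  refine Finset.sum_le_sum fun a _ => ?_
  split_ifs with h
  · rw [← Real.exp_add, Nat.cast_one]
    exact Real.one_le_exp (by nlinarith)
  · rw [Nat.cast_zero]; positivity

lemma sum_exp_rademacher_le {ι : Type*} [Fintype ι] [DecidableEq ι] (a : ι → ℝ) (l : ℝ) :
    ∑ b : ι → Bool, Real.exp (l * ∑ k, a k * signOf (b k)) ≤
      2 ^ Fintype.card ι * Real.exp (l ^ 2 / 2 * ∑ k, a k ^ 2) := by
  have hp := Finset.prod_univ_sum (fun _ : ι => (Finset.univ : Finset Bool))
    (fun k c => Real.exp (l * (a k * signOf c)))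
  rw [Fintype.piFinset_univ] at hp
  have e : ∀ b : ι → Bool, Real.exp (l * ∑ k, a k * signOf (b k)) =
      ∏ k, Real.exp (l * (a k * signOf (b k))) := fun b => by
    rw [Finset.mul_sum, Real.exp_sum]
  simp_rw [e, ← hp, Finset.mul_sum, Real.exp_sum]
  rw [← Finset.card_univ, ← Finset.prod_const, ← Finset.prod_mul_distrib]
  refine Finset.prod_le_prod (fun k _ => Finset.sum_nonneg fun c _ => (Real.exp_pos _).le)
    fun k _ => ?_
  have h := Real.cosh_le_exp_half_sq (l * a k)
  rw [Real.cosh_eq] at h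
  simp only [Fintype.sum_bool, signOf, if_true, Bool.false_eq_true, if_false]
  have e1 : l * (a k * 1) = l * a k := by ring
  have e2 : l * (a k * -1) = -(l * a k) := by ring
  have e3 : l ^ 2 / 2 * a k ^ 2 = (l * a k) ^ 2 / 2 := by ring
  rw [e1, e2, e3]
  linarith

open scoped Classical in
lemma card_rademacher_tail_le {ι : Type*} [Fintype ι] (a : ι → ℝ) {T s : ℝ}
    (hT : 0 ≤ T) (hs : 0 < s) (ha : ∑ k, a k ^ 2 ≤ s) :
    ((Finset.univ.filter fun b : ι → Bool => T ≤ |∑ k, a k * signOf (b k)|).card : ℝ) ≤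
      2 * 2 ^ Fintype.card ι * Real.exp (-T ^ 2 / (2 * s)) := by
  have key : ∀ a : ι → ℝ, ∑ k, a k ^ 2 ≤ s →
      ((Finset.univ.filter fun b : ι → Bool => T ≤ ∑ k, a k * signOf (b k)).card : ℝ) ≤
      2 ^ Fintype.card ι * Real.exp (-T ^ 2 / (2 * s)) := by
    intro a ha
    refine (card_filter_le_exp _ T (T / s) (by positivity)).trans ?_
    refine (mul_le_mul_of_nonneg_left (sum_exp_rademacher_le a (T / s)) (Real.exp_pos _).le).trans ?_
    rw [mul_left_comm, ← Real.exp_add]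
    gcongr
    have : (T / s) ^ 2 / 2 * ∑ k, a k ^ 2 ≤ (T / s) ^ 2 / 2 * s := by gcongr
    have e : -T ^ 2 / (2 * s) = -(T / s * T) + (T / s) ^ 2 / 2 * s := by field_simp; ring
    rw [e]; linarith
  have h1 := key a ha
  have h2 := key (fun k => -a k) (by simpa using ha)
  have hsub : (Finset.univ.filter fun b : ι → Bool => T ≤ |∑ k, a k * signOf (b k)|) ⊆
      (Finset.univ.filter fun b : ι → Bool => T ≤ ∑ k, a k * signOf (b k)) ∪
      (Finset.univ.filter fun b : ι → Bool => T ≤ ∑ k, -a k * signOf (b k)) := by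
    intro b hb
    simpa [le_abs, Finset.sum_neg_distrib] using hb
  have h3 := (Finset.card_le_card hsub).trans (Finset.card_union_le _ _)
  have h4 : ((Finset.univ.filter fun b : ι → Bool => T ≤ |∑ k, a k * signOf (b k)|).card : ℝ) ≤
      (Finset.univ.filter fun b : ι → Bool => T ≤ ∑ k, a k * signOf (b k)).card +
      (Finset.univ.filter fun b : ι → Bool => T ≤ ∑ k, -a k * signOf (b k)).card := by
    exact_mod_cast h3
  linarith

open scoped Classical in
/-- Hoeffding-type bound for sampling with replacement. -/
lemma card_sampling_tail_le {ι : Type*} [Fintype ι] (m : ℕ) (z : ι → ℝ) {B ε : ℝ} (hB : 0 < B)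
    (hε : 0 ≤ ε) (hεB : ε ≤ 2 * B) (hz : ∑ i, z i = 0) (hzB : ∀ i, |z i| ≤ B) :
    ((Finset.univ.filter fun f : Fin m → ι => m * ε ≤ ∑ j, z (f j)).card : ℝ) ≤
      (Fintype.card ι : ℝ) ^ m * Real.exp (-(m * ε ^ 2 / (4 * B ^ 2))) := by
  set l := ε / (2 * B ^ 2) with hl
  have hl0 : 0 ≤ l := by positivity
  refine (card_filter_le_exp _ (m * ε) l hl0).trans ?_
  have hp := Finset.prod_univ_sum (fun _ : Fin m => (Finset.univ : Finset ι))
    (fun _ i => Real.exp (l * z i))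
  rw [Fintype.piFinset_univ] at hp
  have e : ∀ f : Fin m → ι, Real.exp (l * ∑ j, z (f j)) = ∏ j, Real.exp (l * z (f j)) := fun f => by
    rw [Finset.mul_sum, Real.exp_sum]
  simp_rw [e, ← hp]
  rw [Finset.prod_const, Finset.card_univ, Fintype.card_fin]
  have hlB : l * B ≤ 1 := by
    rw [hl, div_mul_eq_mul_div, div_le_one (by positivity)]; nlinarith
  have h1 : ∑ i, Real.exp (l * z i) ≤ Fintype.card ι * Real.exp ((l * B) ^ 2) := by
    have h2 : ∀ i, Real.exp (l * z i) ≤ 1 + l * z i + (l * B) ^ 2 := by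
      intro i
      have h3 : |l * z i| ≤ l * B := by
        rw [abs_mul, abs_of_nonneg hl0]; exact mul_le_mul_of_nonneg_left (hzB i) hl0
      have h4 := Real.abs_exp_sub_one_sub_id_le (h3.trans hlB)
      have h5 : (l * z i) ^ 2 ≤ (l * B) ^ 2 := sq_le_sq' (by linarith [(abs_le.1 h3).1]) (abs_le.1 h3).2
      linarith [(abs_le.1 h4).2]
    refine (Finset.sum_le_sum fun i _ => h2 i).trans ?_
    rw [Finset.sum_add_distrib, Finset.sum_add_distrib, ← Finset.mul_sum, hz]
    simp only [Finset.sum_const, Finset.card_univ, nsmul_eq_mul, mul_one, mul_zero, add_zero]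
    have := Real.add_one_le_exp ((l * B) ^ 2)
    have h6 : (0 : ℝ) ≤ Fintype.card ι := by positivity
    nlinarith
  have h0 : 0 ≤ ∑ i, Real.exp (l * z i) := Finset.sum_nonneg fun i _ => (Real.exp_pos _).le
  refine (mul_le_mul_of_nonneg_left (pow_le_pow_left₀ h0 h1 m) (Real.exp_pos _).le).trans_eq ?_
  rw [mul_pow, mul_left_comm, ← Real.exp_nat_mul, ← Real.exp_add]
  congr 2
  rw [hl]; field_simp; ring

/-- Strictly monotone encodings of `m`-element subsets. -/
abbrev StrictMonoSub (m d : ℕ) := {σ : Fin m → Fin d // StrictMono σ}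

lemma comp_perm_injective (m d : ℕ) : Function.Injective
    fun p : StrictMonoSub m d × Equiv.Perm (Fin m) => p.1.1 ∘ p.2 := by
  rintro ⟨⟨σ, hσ⟩, π⟩ ⟨⟨τ, hτ⟩, ρ⟩ h
  simp only at h
  have hr : Set.range σ = Set.range τ := by
    rw [← π.surjective.range_comp σ, h, ρ.surjective.range_comp τ]
  have hst := (hσ.range_inj hτ).1 hr
  subst hst
  have : π = ρ := Equiv.ext fun i => hσ.injective (congrFun h i)
  rw [this]

lemma pow_le_two_mul_card_strictMono {m d : ℕ} (hd : 0 < d) (hmd : 2 * m ^ 2 ≤ d) :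
    (d : ℝ) ^ m ≤ 2 * (Nat.card (StrictMonoSub m d) * m.factorial) := by
  classical
  have h1 : d.descFactorial m ≤ Nat.card (StrictMonoSub m d) * m.factorial := by
    have e : Fintype.card (Fin m ↪ Fin d) = d.descFactorial m := by simp [Fintype.card_embedding_eq]
    have e2 : Nat.card (StrictMonoSub m d) * m.factorial =
        Fintype.card (StrictMonoSub m d × Equiv.Perm (Fin m)) := by
      rw [Fintype.card_prod, Fintype.card_perm, Fintype.card_fin, Nat.card_eq_fintype_card]
    rw [← e, e2]
    refine Fintype.card_le_of_injective (fun f => (⟨f ∘ Tuple.sort f, ?_⟩, (Tuple.sort f)⁻¹)) ?_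
    · exact (Tuple.monotone_sort f).strictMono_of_injective
        (f.injective.comp (Tuple.sort f).injective)
    · intro f g hfg
      simp only [Prod.mk.injEq, Subtype.mk.injEq, inv_inj] at hfg
      obtain ⟨h1, h2⟩ := hfg
      rw [h2] at h1
      ext i
      have := congrFun h1 ((Tuple.sort g).symm i)
      simp only [Function.comp_apply, Equiv.apply_symm_apply] at this
      rw [this]
  have h2 : (d : ℝ) ^ m ≤ 2 * d.descFactorial m := by
    have h3 := Nat.pow_sub_le_descFactorial d m
    have hm : m ≤ d + 1 := by nlinarith
    have h4 : ((d + 1 - m : ℕ) : ℝ) ^ m ≤ d.descFactorial m := by exact_mod_cast h3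
    rw [Nat.cast_sub hm] at h4
    push_cast at h4
    have hd' : (0 : ℝ) < d := by exact_mod_cast hd
    have hmd' : 2 * (m : ℝ) ^ 2 ≤ d := by exact_mod_cast hmd
    have hm1 : (m : ℝ) ≤ d := by
      have : m ≤ d := by nlinarith
      exact_mod_cast this
    have h5 := one_add_mul_le_pow (a := -((m : ℝ) / d))
      (by have : (m : ℝ) / d ≤ 1 := (div_le_one hd').2 hm1
          linarith) m
    have h6 : (1 / 2 : ℝ) ≤ (1 + -((m : ℝ) / d)) ^ m := by
      refine le_trans ?_ h5
      have : (m : ℝ) * (m / d) ≤ 1 / 2 := by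
        rw [← mul_div_assoc, div_le_iff₀ hd']; linarith
      linarith
    have h7 : (d : ℝ) ^ m * (1 + -((m : ℝ) / d)) ^ m ≤ (d + 1 - m : ℝ) ^ m := by
      rw [← mul_pow]
      apply pow_le_pow_left₀
      · have : (m : ℝ) / d ≤ 1 := (div_le_one hd').2 hm1
        exact mul_nonneg hd'.le (by linarith)
      · have : (d : ℝ) * (1 + -((m : ℝ) / d)) = d - m := by field_simp; ring
        rw [this]; linarith
    have h8 : 0 < (d : ℝ) ^ m := by positivity
    nlinarith
  have h9 : (d.descFactorial m : ℝ) ≤ Nat.card (StrictMonoSub m d) * m.factorial := by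
    exact_mod_cast h1
  linarith

open scoped Classical in
/-- Hoeffding-type bound for sampling without replacement. -/
lemma card_strictMono_tail_le {m d : ℕ} (hd : 0 < d) (hmd : 2 * m ^ 2 ≤ d) (z : Fin d → ℝ)
    {B ε : ℝ} (hB : 0 < B) (hε : 0 ≤ ε) (hεB : ε ≤ 2 * B) (hz : ∑ i, z i = 0)
    (hzB : ∀ i, |z i| ≤ B) :
    ((Finset.univ.filter fun σ : StrictMonoSub m d => m * ε ≤ |∑ j, z (σ.1 j)|).card : ℝ) ≤
      4 * Nat.card (StrictMonoSub m d) * Real.exp (-(m * ε ^ 2 / (4 * B ^ 2))) := by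
  have key : ∀ z : Fin d → ℝ, ∑ i, z i = 0 → (∀ i, |z i| ≤ B) →
      ((Finset.univ.filter fun σ : StrictMonoSub m d => m * ε ≤ ∑ j, z (σ.1 j)).card : ℝ) ≤
      2 * Nat.card (StrictMonoSub m d) * Real.exp (-(m * ε ^ 2 / (4 * B ^ 2))) := by
    intro z hz hzB
    have h1 := card_sampling_tail_le m z hB hε hεB hz hzB
    rw [Fintype.card_fin] at h1
    have h2 : (Finset.univ.filter fun σ : StrictMonoSub m d => m * ε ≤ ∑ j, z (σ.1 j)).card *
        m.factorial ≤ (Finset.univ.filter fun f : Fin m → Fin d => m * ε ≤ ∑ j, z (f j)).card := by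
      have e : m.factorial = (Finset.univ : Finset (Equiv.Perm (Fin m))).card := by
        rw [Finset.card_univ, Fintype.card_perm, Fintype.card_fin]
      rw [e, ← Finset.card_product]
      refine Finset.card_le_card_of_injOn _ ?_ (comp_perm_injective m d).injOn
      rintro ⟨σ, π⟩ hσ
      simp only [Finset.coe_product, Set.mem_prod, Finset.mem_coe, Finset.mem_filter,
        Finset.mem_univ, true_and, and_true] at hσ ⊢
      refine hσ.trans_eq ?_
      exact (Equiv.sum_comp π fun j => z (σ.1 j)).symm
    have h3 : ((Finset.univ.filter fun σ : StrictMonoSub m d => m * ε ≤ ∑ j, z (σ.1 j)).card : ℝ) *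
        m.factorial ≤ (Finset.univ.filter fun f : Fin m → Fin d => m * ε ≤ ∑ j, z (f j)).card := by
      exact_mod_cast h2
    have h4 := pow_le_two_mul_card_strictMono hd hmd
    have hf : (0 : ℝ) < m.factorial := by exact_mod_cast m.factorial_pos
    have h5 := mul_le_mul_of_nonneg_right h4 (Real.exp_pos (-(m * ε ^ 2 / (4 * B ^ 2)))).le
    refine le_of_mul_le_mul_right ?_ hf
    linarith
  have h1 := key z hz hzB
  have h2 := key (fun i => -z i) (by simpa using hz) (by simpa using hzB)
  have hsub : (Finset.univ.filter fun σ : StrictMonoSub m d => m * ε ≤ |∑ j, z (σ.1 j)|) ⊆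
      (Finset.univ.filter fun σ : StrictMonoSub m d => m * ε ≤ ∑ j, z (σ.1 j)) ∪
      (Finset.univ.filter fun σ : StrictMonoSub m d => m * ε ≤ ∑ j, -z (σ.1 j)) := by
    intro b hb
    simpa [le_abs, Finset.sum_neg_distrib] using hb
  have h3 := (Finset.card_le_card hsub).trans (Finset.card_union_le _ _)
  have h4 : ((Finset.univ.filter fun σ : StrictMonoSub m d =>
      m * ε ≤ |∑ j, z (σ.1 j)|).card : ℝ) ≤
      (Finset.univ.filter fun σ : StrictMonoSub m d => m * ε ≤ ∑ j, z (σ.1 j)).card +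
      (Finset.univ.filter fun σ : StrictMonoSub m d => m * ε ≤ ∑ j, -z (σ.1 j)).card := by
    exact_mod_cast h3
  linarith

lemma sum_fastEmbed_sq (n m : ℕ) (σ : Fin m → Fin (2 ^ n)) (b : Fin (2 ^ n) → Bool)
    (x : Fin (2 ^ n) → ℝ) :
    ∑ j, fastEmbed n m σ b x j ^ 2 = (m : ℝ)⁻¹ * ∑ j, hadamardCoord n b x (σ j) ^ 2 := by
  rw [Finset.mul_sum]
  refine Finset.sum_congr rfl fun j _ => ?_
  rw [fastEmbed, mul_pow, inv_pow, Real.sq_sqrt (Nat.cast_nonneg m)]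
  rfl

open scoped Classical in
/-- The number of `(S, b)` for which the embedding distorts the squared norm of `x` by at
least `ε`. -/
lemma card_distortion_le {n m : ℕ} (hm : 0 < m) (hmd : 2 * m ^ 2 ≤ 2 ^ n)
    (x : Fin (2 ^ n) → ℝ) {s ε T : ℝ} (hs : ∑ k, x k ^ 2 = s) (hs4 : s ≤ 4) (hT : 2 ≤ T)
    (hε : 0 ≤ ε) (hε1 : ε ≤ 1) :
    ((Finset.univ.filter fun p : (Fin (2 ^ n) → Bool) × StrictMonoSub m (2 ^ n) =>
      ε ≤ |∑ j, fastEmbed n m p.2.1 p.1 x j ^ 2 - s|).card : ℝ) ≤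
    2 ^ 2 ^ n * Nat.card (StrictMonoSub m (2 ^ n)) *
      (2 * 2 ^ n * Real.exp (-T ^ 2 / 8) + 4 * Real.exp (-(m * ε ^ 2 / (4 * T ^ 4)))) := by
  set M : ℝ := (Nat.card (StrictMonoSub m (2 ^ n)) : ℝ) with hM
  set q := Real.exp (-(m * ε ^ 2 / (4 * T ^ 4))) with hq
  have hM0 : 0 ≤ M := Nat.cast_nonneg _
  have hs0 : 0 ≤ s := by rw [← hs]; exact Finset.sum_nonneg fun k _ => sq_nonneg _
  have hmpos : (0 : ℝ) < m := by exact_mod_cast hm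
  set bad : Finset (Fin (2 ^ n) → Bool) :=
    Finset.univ.filter fun b => ∃ i, T ≤ |hadamardCoord n b x i| with hbad
  have hbadcard : (bad.card : ℝ) ≤ 2 ^ 2 ^ n * (2 * 2 ^ n * Real.exp (-T ^ 2 / 8)) := by
    have h1 : bad ⊆ Finset.univ.biUnion fun i => Finset.univ.filter fun b : Fin (2 ^ n) → Bool =>
        T ≤ |∑ k, (hadamardEntry n i k * x k) * signOf (b k)| := by
      intro b hb
      simp only [hbad, Finset.mem_filter, Finset.mem_univ, true_and, Finset.mem_biUnion] at hb ⊢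
      obtain ⟨i, hi⟩ := hb
      refine ⟨i, hi.trans_eq ?_⟩
      rw [hadamardCoord]
      congr 1
      exact Finset.sum_congr rfl fun k _ => by ring
    have h2 := (Finset.card_le_card h1).trans Finset.card_biUnion_le
    have h3 : (bad.card : ℝ) ≤ ∑ i, ((Finset.univ.filter fun b : Fin (2 ^ n) → Bool =>
        T ≤ |∑ k, (hadamardEntry n i k * x k) * signOf (b k)|).card : ℝ) := by exact_mod_cast h2
    have h4 : ∀ i, ((Finset.univ.filter fun b : Fin (2 ^ n) → Bool =>
        T ≤ |∑ k, (hadamardEntry n i k * x k) * signOf (b k)|).card : ℝ) ≤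
        2 * 2 ^ 2 ^ n * Real.exp (-T ^ 2 / 8) := by
      intro i
      have h := card_rademacher_tail_le (fun k => hadamardEntry n i k * x k) (T := T) (s := 4)
        (by linarith) (by norm_num)
        (by simp_rw [mul_pow, hadamardEntry_sq, one_mul]; linarith)
      rw [Fintype.card_fin, show (2 : ℝ) * 4 = 8 by norm_num] at h
      convert h
    refine h3.trans ((Finset.sum_le_sum fun i _ => h4 i).trans (le_of_eq ?_))
    rw [Finset.sum_const, Finset.card_univ, Fintype.card_fin, nsmul_eq_mul, Nat.cast_pow,
      Nat.cast_ofNat]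
    ring
  have hgood : ∀ b ∉ bad, ((Finset.univ.filter fun σ : StrictMonoSub m (2 ^ n) =>
      ε ≤ |∑ j, fastEmbed n m σ.1 b x j ^ 2 - s|).card : ℝ) ≤ 4 * M * q := by
    intro b hb
    simp only [hbad, Finset.mem_filter, Finset.mem_univ, true_and, not_exists, not_le] at hb
    have h := card_strictMono_tail_le (m := m) (d := 2 ^ n) (by positivity) hmd
      (fun i => hadamardCoord n b x i ^ 2 - s) (B := T ^ 2) (ε := ε) (by positivity) hε
      (by nlinarith) (by
        rw [Finset.sum_sub_distrib, sum_hadamardCoord_sq, hs, Finset.sum_const, Finset.card_univ,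
          Fintype.card_fin, nsmul_eq_mul]
        push_cast; ring) (by
        intro i
        have h1 : hadamardCoord n b x i ^ 2 ≤ T ^ 2 := sq_le_sq' (by linarith [(abs_lt.1 (hb i)).1])
          (abs_lt.1 (hb i)).2.le
        rw [abs_le]
        constructor <;> nlinarith [sq_nonneg (hadamardCoord n b x i)])
    have e : (T ^ 2) ^ 2 = T ^ 4 := by ring
    rw [e] at h
    refine le_trans ?_ h
    rw [Nat.cast_le]
    refine Finset.card_le_card fun σ hσ => ?_
    simp only [Finset.mem_filter, Finset.mem_univ, true_and] at hσ ⊢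
    rw [sum_fastEmbed_sq] at hσ
    have e2 : ∑ j, (hadamardCoord n b x (σ.1 j) ^ 2 - s) =
        m * ((m : ℝ)⁻¹ * ∑ j, hadamardCoord n b x (σ.1 j) ^ 2 - s) := by
      rw [Finset.sum_sub_distrib, Finset.sum_const, Finset.card_univ, Fintype.card_fin,
        nsmul_eq_mul]
      field_simp
    rw [e2, abs_mul, abs_of_pos hmpos]
    gcongr
  have hsplit : ((Finset.univ.filter fun p : (Fin (2 ^ n) → Bool) × StrictMonoSub m (2 ^ n) =>
      ε ≤ |∑ j, fastEmbed n m p.2.1 p.1 x j ^ 2 - s|).card : ℝ) =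
      ∑ b, ((Finset.univ.filter fun σ : StrictMonoSub m (2 ^ n) =>
      ε ≤ |∑ j, fastEmbed n m σ.1 b x j ^ 2 - s|).card : ℝ) := by
    simp only [Finset.card_filter, Nat.cast_sum]
    rw [Fintype.sum_prod_type]
  rw [hsplit]
  have hb : ∀ b, ((Finset.univ.filter fun σ : StrictMonoSub m (2 ^ n) =>
      ε ≤ |∑ j, fastEmbed n m σ.1 b x j ^ 2 - s|).card : ℝ) ≤
      M * (if b ∈ bad then 1 else 0) + 4 * M * q := by
    intro b
    split_ifs with h
    · have : ((Finset.univ.filter fun σ : StrictMonoSub m (2 ^ n) =>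
          ε ≤ |∑ j, fastEmbed n m σ.1 b x j ^ 2 - s|).card : ℝ) ≤ M := by
        rw [hM, Nat.card_eq_fintype_card]
        exact_mod_cast Finset.card_le_univ _
      have : 0 ≤ 4 * M * q := by positivity
      linarith
    · have := hgood b h
      linarith
  refine (Finset.sum_le_sum fun b _ => hb b).trans ?_
  rw [Finset.sum_add_distrib, ← Finset.mul_sum, Finset.sum_ite_mem, Finset.univ_inter,
    Finset.sum_const, Finset.sum_const, Finset.card_univ, Fintype.card_fun, Fintype.card_bool,
    Fintype.card_fin, nsmul_eq_mul, nsmul_eq_mul, mul_one]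
  push_cast
  nlinarith [mul_le_mul_of_nonneg_left hbadcard hM0]

lemma measurableSet_collide {α β : Type*} [MeasurableSpace α] [MeasurableSpace β]
    [Countable α] [Countable β] [MeasurableSingletonClass α] [MeasurableSingletonClass β]
    {m N : ℕ} (f g : α → β → Fin m → ℝ) :
    MeasurableSet {ω : α × β × (Fin N → Fin m → ℝ) |
      collide ω.2.2 (f ω.1 ω.2.1) (g ω.1 ω.2.1)} := by
  have hmv : ∀ (u : α → β → Fin m → ℝ) (i : Fin N), Measurable
      fun ω : α × β × (Fin N → Fin m → ℝ) => mvMul ω.2.2 (u ω.1 ω.2.1) i := by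
    intro u i
    unfold mvMul
    refine Finset.measurable_sum _ fun j _ => Measurable.mul (by fun_prop) ?_
    have hF : Measurable fun p : α × β => u p.1 p.2 j := measurable_of_countable _
    exact hF.comp (measurable_fst.prodMk (measurable_fst.comp measurable_snd))
  have hh : ∀ (u : α → β → Fin m → ℝ) (i : Fin N) (s : ℝ), MeasurableSet
      {ω : α × β × (Fin N → Fin m → ℝ) | hashAt ω.2.2 (u ω.1 ω.2.1) i s} := by
    intro u i s
    have e : {ω : α × β × (Fin N → Fin m → ℝ) | hashAt ω.2.2 (u ω.1 ω.2.1) i s} =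
        ⋂ j, ⋂ (_ : j ≠ i),
        {ω | |mvMul ω.2.2 (u ω.1 ω.2.1) j| < s * mvMul ω.2.2 (u ω.1 ω.2.1) i} := by
      ext ω; simp [hashAt]
    rw [e]
    exact MeasurableSet.iInter fun j => MeasurableSet.iInter fun _ =>
      measurableSet_lt (hmv u j).abs ((hmv u i).const_mul s)
  have e : {ω : α × β × (Fin N → Fin m → ℝ) | collide ω.2.2 (f ω.1 ω.2.1) (g ω.1 ω.2.1)} =
      ⋃ i : Fin N, (({ω | hashAt ω.2.2 (f ω.1 ω.2.1) i 1} ∩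
        {ω | hashAt ω.2.2 (g ω.1 ω.2.1) i 1}) ∪
        ({ω | hashAt ω.2.2 (f ω.1 ω.2.1) i (-1)} ∩
        {ω | hashAt ω.2.2 (g ω.1 ω.2.1) i (-1)})) := by
    ext ω
    simp [collide, or_and_right, exists_or]
  rw [e]
  exact MeasurableSet.iUnion fun i =>
    ((hh f i 1).inter (hh g i 1)).union ((hh f i (-1)).inter (hh g i (-1)))

/-- The collision probability averages the Gaussian collision probability over `(S, b)`. -/
lemma fastCollProb_eq (n m N : ℕ) (x y : Fin (2 ^ n) → ℝ) :
    fastCollProb n m N x y = (2 ^ 2 ^ n * Nat.card (StrictMonoSub m (2 ^ n)) : ℝ)⁻¹ *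
      ∑ p : (Fin (2 ^ n) → Bool) × StrictMonoSub m (2 ^ n), (gaussMatrix N m).real
        {A | collide A (fastEmbed n m p.2.1 p.1 x) (fastEmbed n m p.2.1 p.1 y)} := by
  have hs := measurableSet_collide (N := N)
    (fun (σ : StrictMonoSub m (2 ^ n)) b => fastEmbed n m σ.1 b x) fun σ b => fastEmbed n m σ.1 b y
  unfold fastCollProb fastMeasure
  rw [Measure.prod_apply hs, uniformCount, lintegral_smul_measure, lintegral_count, tsum_fintype,
    Fintype.sum_prod_type_right, mul_inv, mul_comm ((2 : ℝ) ^ 2 ^ n)⁻¹, mul_assoc, smul_eq_mul,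
    ENNReal.toReal_mul, ENNReal.toReal_inv, ENNReal.toReal_natCast]
  have h1 : ∀ σ : StrictMonoSub m (2 ^ n),
      ((uniformCount (Fin (2 ^ n) → Bool)).prod (gaussMatrix N m)) (Prod.mk σ ⁻¹'
        {ω | collide ω.2.2 (fastEmbed n m ω.1.1 ω.2.1 x) (fastEmbed n m ω.1.1 ω.2.1 y)}) =
      (2 ^ 2 ^ n)⁻¹ * ∑ b, gaussMatrix N m
        {A | collide A (fastEmbed n m σ b x) (fastEmbed n m σ b y)} := by
    intro σ
    rw [Measure.prod_apply (measurable_prodMk_left hs), uniformCount, lintegral_smul_measure,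
      lintegral_count, tsum_fintype, smul_eq_mul]
    simp
  simp_rw [h1]
  rw [← Finset.mul_sum, ENNReal.toReal_mul, ENNReal.toReal_sum (fun σ _ => ENNReal.sum_ne_top.2
    fun b _ => measure_ne_top _ _)]
  simp_rw [ENNReal.toReal_sum fun _ _ => measure_ne_top _ _]
  simp [Measure.real]

lemma fastEmbed_add (n m : ℕ) (σ : Fin m → Fin (2 ^ n)) (b : Fin (2 ^ n) → Bool)
    (x y : Fin (2 ^ n) → ℝ) (j : Fin m) :
    fastEmbed n m σ b (fun k => x k + y k) j = fastEmbed n m σ b x j + fastEmbed n m σ b y j := by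
  simp only [fastEmbed, mul_add, Finset.sum_add_distrib]

lemma card_strictMono_pos {m d : ℕ} (hd : 0 < d) (hmd : 2 * m ^ 2 ≤ d) :
    (0 : ℝ) < Nat.card (StrictMonoSub m d) := by
  have h := pow_le_two_mul_card_strictMono hd hmd
  have h1 : (0 : ℝ) < (d : ℝ) ^ m := by positivity
  by_contra h2
  have h3 : (Nat.card (StrictMonoSub m d) : ℝ) = 0 :=
    le_antisymm (not_lt.1 h2) (Nat.cast_nonneg _)
  rw [h3] at h
  linarith

/-- Conditioning on the embedding being nearly isometric on `x`, `y` and `x + y`. -/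
lemma fastCollProb_bounds {n m N : ℕ} (hm : 0 < m) (hmd : 2 * m ^ 2 ≤ 2 ^ n)
    {x y : Fin (2 ^ n) → ℝ} {κ ε T lo hi q : ℝ} (hx : ∑ k, x k ^ 2 = 1) (hy : ∑ k, y k ^ 2 = 1)
    (hxy : ∑ k, (x k + y k) ^ 2 = 2 * κ) (hκ : κ ≤ 2) (hT : 2 ≤ T) (hε : 0 ≤ ε) (hε1 : ε ≤ 1)
    (hq : 3 * (2 * 2 ^ n * Real.exp (-T ^ 2 / 8) + 4 * Real.exp (-(m * ε ^ 2 / (4 * T ^ 4)))) ≤ q)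
    (hlo : 0 ≤ lo) (hhi : 0 ≤ hi)
    (h : ∀ v w : Fin m → ℝ, |∑ j, v j ^ 2 - 1| < ε → |∑ j, w j ^ 2 - 1| < ε →
      |∑ j, (v j + w j) ^ 2 - 2 * κ| < ε →
      lo ≤ (gaussMatrix N m).real {A | collide A v w} ∧
        (gaussMatrix N m).real {A | collide A v w} ≤ hi) :
    (1 - q) * lo ≤ fastCollProb n m N x y ∧ fastCollProb n m N x y ≤ q + hi := by
  classical
  set M : ℝ := (Nat.card (StrictMonoSub m (2 ^ n)) : ℝ) with hM
  have hMpos : 0 < M := card_strictMono_pos (by positivity) hmd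
  set K : ℝ := 2 ^ 2 ^ n * M with hK
  have hKpos : 0 < K := by positivity
  set P : (Fin (2 ^ n) → Bool) × StrictMonoSub m (2 ^ n) → ℝ := fun p => (gaussMatrix N m).real
    {A | collide A (fastEmbed n m p.2.1 p.1 x) (fastEmbed n m p.2.1 p.1 y)} with hP
  set bad : (Fin (2 ^ n) → ℝ) → ℝ → Finset ((Fin (2 ^ n) → Bool) × StrictMonoSub m (2 ^ n)) :=
    fun u s => Finset.univ.filter fun p =>
      ε ≤ |∑ j, fastEmbed n m p.2.1 p.1 u j ^ 2 - s| with hbad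
  set B := bad x 1 ∪ bad y 1 ∪ bad (fun k => x k + y k) (2 * κ) with hB
  have hBcard : (B.card : ℝ) ≤ K * q := by
    have h1 : (B.card : ℝ) ≤ (bad x 1).card + (bad y 1).card +
        (bad (fun k => x k + y k) (2 * κ)).card := by
      have h2 := Finset.card_union_le (bad x 1 ∪ bad y 1) (bad (fun k => x k + y k) (2 * κ))
      have h3 := Finset.card_union_le (bad x 1) (bad y 1)
      exact_mod_cast h2.trans (by omega)
    have hc : ∀ (u : Fin (2 ^ n) → ℝ) (s : ℝ), ∑ k, u k ^ 2 = s → s ≤ 4 →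
        ((bad u s).card : ℝ) ≤ K * (2 * 2 ^ n * Real.exp (-T ^ 2 / 8) +
          4 * Real.exp (-(m * ε ^ 2 / (4 * T ^ 4)))) := by
      intro u s hs hs4
      have := card_distortion_le hm hmd u hs hs4 hT hε hε1
      convert this
    have hbx := hc x 1 hx (by norm_num)
    have hby := hc y 1 hy (by norm_num)
    have hbxy := hc _ _ hxy (by linarith)
    have := mul_le_mul_of_nonneg_left hq hKpos.le
    linarith
  have hgood : ∀ p ∉ B, lo ≤ P p ∧ P p ≤ hi := by
    intro p hp
    simp only [hB, hbad, Finset.mem_union, Finset.mem_filter, Finset.mem_univ, true_and, not_or,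
      not_le, fastEmbed_add] at hp
    exact h _ _ hp.1.1 hp.1.2 hp.2
  have hcardK : ((Finset.univ : Finset ((Fin (2 ^ n) → Bool) × StrictMonoSub m (2 ^ n))).card : ℝ)
      = K := by
    rw [Finset.card_univ, Fintype.card_prod, hK, hM, Nat.card_eq_fintype_card]
    simp
  have hind : ∑ p : (Fin (2 ^ n) → Bool) × StrictMonoSub m (2 ^ n), (if p ∈ B then (1 : ℝ) else 0) =
      B.card := by
    simp
  have hup : ∑ p, P p ≤ K * (q + hi) := by
    have h1 : ∀ p, P p ≤ hi + (if p ∈ B then (1 : ℝ) else 0) := by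
      intro p
      split_ifs with hp
      · have : P p ≤ 1 := measureReal_le_one
        linarith
      · simpa using (hgood p hp).2
    refine (Finset.sum_le_sum fun p _ => h1 p).trans ?_
    rw [Finset.sum_add_distrib, hind, Finset.sum_const, nsmul_eq_mul, hcardK]
    linarith
  have hdown : K * ((1 - q) * lo) ≤ ∑ p, P p := by
    have h1 : ∀ p, lo - lo * (if p ∈ B then (1 : ℝ) else 0) ≤ P p := by
      intro p
      split_ifs with hp
      · have : 0 ≤ P p := measureReal_nonneg
        linarith
      · simpa using (hgood p hp).1
    refine le_trans ?_ (Finset.sum_le_sum fun p _ => h1 p)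
    rw [Finset.sum_sub_distrib, ← Finset.mul_sum, hind, Finset.sum_const, nsmul_eq_mul, hcardK]
    have := mul_le_mul_of_nonneg_left hBcard hlo
    linarith
  rw [fastCollProb_eq]
  change _ ≤ K⁻¹ * ∑ p, P p ∧ K⁻¹ * ∑ p, P p ≤ _
  rw [inv_mul_eq_div, le_div_iff₀ hKpos, div_le_iff₀ hKpos]
  constructor <;> linarith

lemma le_emDim {d : ℕ} (h : 1 ≤ Real.log (Real.log d)) : Real.log d ^ 5 ≤ emDim 1 d := by
  have h0 : 0 ≤ Real.log d := Real.log_natCast_nonneg d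
  refine le_trans ?_ (Nat.le_ceil _)
  rw [one_mul]
  exact le_mul_of_one_le_right (by positivity) (one_le_pow₀ h)

lemma emDim_le {d : ℕ} (h1 : 1 ≤ Real.log d) : (emDim 1 d : ℝ) ≤ 2 * Real.log d ^ 9 := by
  have h2 : Real.log (Real.log d) ≤ Real.log d := by
    have := Real.log_le_sub_one_of_pos (by linarith : 0 < Real.log d)
    linarith
  have h3 : 0 ≤ Real.log (Real.log d) := Real.log_nonneg h1
  have h4 : 1 ≤ Real.log d ^ 9 := one_le_pow₀ h1
  have h5 : 1 * Real.log d ^ 5 * Real.log (Real.log d) ^ 4 ≤ Real.log d ^ 9 := by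
    have : Real.log (Real.log d) ^ 4 ≤ Real.log d ^ 4 := pow_le_pow_left₀ h3 h2 4
    calc 1 * Real.log d ^ 5 * Real.log (Real.log d) ^ 4
        ≤ 1 * Real.log d ^ 5 * Real.log d ^ 4 := by gcongr
      _ = Real.log d ^ 9 := by ring
  have h6 := Nat.ceil_lt_add_one (a := 1 * Real.log d ^ 5 * Real.log (Real.log d) ^ 4)
    (by positivity)
  unfold emDim
  linarith

lemma tendsto_log_two_pow : Tendsto (fun n : ℕ => Real.log ((2 ^ n : ℕ) : ℝ)) atTop atTop :=
  Real.tendsto_log_atTop.comp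
    (tendsto_natCast_atTop_atTop.comp (tendsto_pow_atTop_atTop_of_one_lt one_lt_two))

/-- The embedding dimension is large enough for a polynomially small failure probability. -/
lemma eventually_emDim_params {a ε : ℝ} (ha : 0 < a) (hε : 0 < ε) :
    ∀ᶠ n : ℕ in atTop, 0 < emDim 1 (2 ^ n) ∧ 2 * emDim 1 (2 ^ n) ^ 2 ≤ 2 ^ n ∧
      ∃ T : ℝ, 2 ≤ T ∧ 3 * (2 * 2 ^ n * Real.exp (-T ^ 2 / 8) +
        4 * Real.exp (-((emDim 1 (2 ^ n) : ℕ) * ε ^ 2 / (4 * T ^ 4)))) ≤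
        Real.exp (-a * Real.log ((2 ^ n : ℕ) : ℝ)) := by
  have e1 : ∀ᶠ l : ℝ in atTop, l ^ 18 * Real.exp (-l) < 1 / 8 :=
    (Real.tendsto_pow_mul_exp_neg_atTop_nhds_zero 18).eventually (gt_mem_nhds (by norm_num))
  have e2 : ∀ᶠ l : ℝ in atTop, 1 ≤ Real.log l := Real.tendsto_log_atTop.eventually_ge_atTop 1
  have e3 : ∀ᶠ l : ℝ in atTop, 18 ≤ Real.exp l := Real.tendsto_exp_atTop.eventually_ge_atTop 18
  have e4 : ∀ᶠ l : ℝ in atTop, 256 * (a + 1) * (a + 2) ^ 2 / ε ^ 2 ≤ l ^ 2 :=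
    (tendsto_pow_atTop two_ne_zero).eventually_ge_atTop _
  filter_upwards [tendsto_log_two_pow.eventually (e1.and (e2.and (e3.and (e4.and
    (eventually_ge_atTop 1)))))] with n hn
  obtain ⟨h1, h2, h3, h4, h5⟩ := hn
  set l := Real.log ((2 ^ n : ℕ) : ℝ) with hl
  have hexp : Real.exp l = 2 ^ n := by
    rw [hl, Real.exp_log (by positivity)]; push_cast; rfl
  have hm1 : l ^ 5 ≤ emDim 1 (2 ^ n) := le_emDim h2
  have hm2 : (emDim 1 (2 ^ n) : ℝ) ≤ 2 * l ^ 9 := emDim_le h5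
  set m := emDim 1 (2 ^ n)
  have hmpos : (0 : ℝ) < m := lt_of_lt_of_le (by positivity) hm1
  refine ⟨by exact_mod_cast hmpos, ?_, ?_⟩
  · have h6 : l ^ 18 * 8 ≤ Real.exp l := by
      rw [Real.exp_neg, ← div_eq_mul_inv, div_lt_iff₀ (Real.exp_pos _)] at h1
      linarith
    rw [hexp] at h6
    have h7 : 2 * (m : ℝ) ^ 2 ≤ 2 ^ n := by
      have : (m : ℝ) ^ 2 ≤ (2 * l ^ 9) ^ 2 := pow_le_pow_left₀ hmpos.le hm2 2
      have e : (2 * l ^ 9) ^ 2 = 4 * l ^ 18 := by ring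
      linarith
    exact_mod_cast h7
  · have hT0 : 0 ≤ 8 * (a + 2) * l := by positivity
    refine ⟨Real.sqrt (8 * (a + 2) * l), ?_, ?_⟩
    · refine Real.le_sqrt_of_sq_le ?_
      nlinarith
    · have hT4 : Real.sqrt (8 * (a + 2) * l) ^ 4 = 64 * (a + 2) ^ 2 * l ^ 2 := by
        rw [show 4 = 2 * 2 from rfl, pow_mul, Real.sq_sqrt hT0]; ring
      rw [hT4, Real.sq_sqrt hT0]
      have h8 : 2 * 2 ^ n * Real.exp (-(8 * (a + 2) * l) / 8) = 2 * Real.exp (-(a + 1) * l) := by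
        rw [← hexp, mul_assoc, ← Real.exp_add]
        congr 2; ring
      have h9 : (a + 1) * l ≤ m * ε ^ 2 / (4 * (64 * (a + 2) ^ 2 * l ^ 2)) := by
        rw [le_div_iff₀ (by positivity)]
        rw [div_le_iff₀ (by positivity)] at h4
        calc (a + 1) * l * (4 * (64 * (a + 2) ^ 2 * l ^ 2))
            = 256 * (a + 1) * (a + 2) ^ 2 * l ^ 3 := by ring
          _ ≤ l ^ 2 * ε ^ 2 * l ^ 3 := by gcongr
          _ = l ^ 5 * ε ^ 2 := by ring
          _ ≤ m * ε ^ 2 := by gcongr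
      have h10 : Real.exp (-(m * ε ^ 2 / (4 * (64 * (a + 2) ^ 2 * l ^ 2)))) ≤
          Real.exp (-(a + 1) * l) := Real.exp_le_exp.2 (by linarith)
      have h11 : Real.exp (-a * l) = Real.exp l * Real.exp (-(a + 1) * l) := by
        rw [← Real.exp_add]; congr 1; ring
      rw [h8, h11]
      have := mul_le_mul_of_nonneg_right h3 (Real.exp_pos (-(a + 1) * l)).le
      linarith

lemma abs_log_inv_div_sub_lt {ρ δ L p : ℝ} (hδ : 0 < δ) (hL : 0 < L)
    (hL1 : Real.log 2 ≤ L * δ) (hL2 : Real.log 2 ≤ L * ρ)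
    (hlo : (1 - Real.exp (-ρ * L)) * Real.exp (-(ρ + δ) * L) ≤ p)
    (hhi : p ≤ Real.exp (-ρ * L) + Real.exp (-(ρ - δ) * L)) :
    |Real.log (1 / p) / L - ρ| < 4 * δ := by
  have h2δ : 2 ≤ Real.exp (δ * L) := by
    rw [← Real.log_le_iff_le_exp two_pos]; linarith
  have h2ρ : Real.exp (-ρ * L) ≤ 1 / 2 := by
    rw [neg_mul, Real.exp_neg, one_div]
    refine inv_anti₀ two_pos ?_
    rw [← Real.log_le_iff_le_exp two_pos]; linarith
  have hplo : Real.exp (-(ρ + 2 * δ) * L) ≤ p := by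
    have e : Real.exp (-(ρ + δ) * L) = Real.exp (δ * L) * Real.exp (-(ρ + 2 * δ) * L) := by
      rw [← Real.exp_add]; congr 1; ring
    have h1 := mul_le_mul_of_nonneg_right h2δ (Real.exp_pos (-(ρ + 2 * δ) * L)).le
    have h2 := mul_le_mul_of_nonneg_right h2ρ (Real.exp_pos (-(ρ + δ) * L)).le
    linarith
  have hphi : p ≤ Real.exp (-(ρ - 2 * δ) * L) := by
    have e : Real.exp (-(ρ - 2 * δ) * L) = Real.exp (δ * L) * Real.exp (-(ρ - δ) * L) := by
      rw [← Real.exp_add]; congr 1; ring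
    have h1 : Real.exp (-ρ * L) ≤ Real.exp (-(ρ - δ) * L) := by
      refine Real.exp_le_exp.2 ?_
      have := mul_pos hδ hL
      linarith
    have h2 := mul_le_mul_of_nonneg_right h2δ (Real.exp_pos (-(ρ - δ) * L)).le
    linarith
  have hppos : 0 < p := (Real.exp_pos _).trans_le hplo
  have hlog1 := (Real.le_log_iff_exp_le hppos).2 hplo
  have hlog2 := (Real.log_le_iff_le_exp hppos).2 hphi
  have hδL := mul_pos hδ hL
  rw [one_div, Real.log_inv, abs_lt, lt_sub_iff_add_lt, sub_lt_iff_lt_add,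
    lt_div_iff₀ hL, div_lt_iff₀ hL]
  constructor <;> linarith

lemma fastCollProb_exponent {R : ℝ} (hR : 0 < R) (hR2 : R < 2) (d' : ℕ → ℕ)
    (x y : (n : ℕ) → EuclideanSpace ℝ (Fin (2 ^ n)))
    (h : ∀ᶠ n in atTop, emDim 1 (2 ^ n) ≤ d' n ∧ d' n ≤ 2 ^ n ∧
      ‖x n‖ = 1 ∧ ‖y n‖ = 1 ∧ ‖x n - y n‖ = R) :
    Tendsto (fun n => Real.log (1 / fastCollProb n (emDim 1 (2 ^ n)) (d' n)
      (fun i => x n i) (fun i => y n i)) / Real.log (d' n)) atTop (nhds (R ^ 2 / (4 - R ^ 2))) := by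
  set ρ := R ^ 2 / (4 - R ^ 2) with hρ
  have h4 : 0 < 4 - R ^ 2 := by nlinarith
  have hρpos : 0 < ρ := by positivity
  set κ := 2 - R ^ 2 / 2 with hκ
  have hκpos : 0 < κ := by rw [hκ]; linarith
  have hκρ : 2 / κ - 1 = ρ := by
    rw [hκ, hρ]
    rw [show 2 - R ^ 2 / 2 = (4 - R ^ 2) / 2 by ring]
    field_simp
    ring
  have hlogm : Tendsto (fun n => Real.log ((2 ^ n : ℕ) : ℝ) ^ 5) atTop atTop :=
    (tendsto_pow_atTop (by norm_num)).comp tendsto_log_two_pow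
  have hd' : Tendsto d' atTop atTop := by
    rw [← tendsto_natCast_atTop_iff (R := ℝ)]
    refine tendsto_atTop_mono' _ ?_ hlogm
    filter_upwards [h, (Real.tendsto_log_atTop.comp tendsto_log_two_pow).eventually_ge_atTop 1]
      with n hn h1
    exact (le_emDim h1).trans (by exact_mod_cast hn.1)
  have hL : Tendsto (fun n => Real.log (d' n)) atTop atTop :=
    Real.tendsto_log_atTop.comp (tendsto_natCast_atTop_atTop.comp hd')
  rw [Metric.tendsto_nhds]
  simp_rw [Real.dist_eq]
  intro δ' hδ'
  obtain ⟨δ, hδ, rfl⟩ : ∃ δ, 0 < δ ∧ δ' = 4 * δ := ⟨δ' / 4, by positivity, by ring⟩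
  obtain ⟨ε, hε, hcoll⟩ := gaussMatrix_collide_exponent hκpos hδ
  rw [hκρ] at hcoll
  have hmin : 0 < min ε 1 := lt_min hε one_pos
  filter_upwards [h, hd'.eventually hcoll, eventually_emDim_params hρpos hmin,
    hL.eventually_ge_atTop (Real.log 2 / δ), hL.eventually_ge_atTop (Real.log 2 / ρ),
    hL.eventually_ge_atTop 1] with n hn hc hp hL1 hL2 hL3
  obtain ⟨-, hdn, hx, hy, hxy⟩ := hn
  obtain ⟨hm, hmd, T, hT, hq⟩ := hp
  set L := Real.log (d' n) with hLd
  have hLl : L ≤ Real.log ((2 ^ n : ℕ) : ℝ) := by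
    rcases Nat.eq_zero_or_pos (d' n) with h0 | h0
    · rw [hLd, h0] at hL3; norm_num at hL3
    · exact Real.log_le_log (by exact_mod_cast h0) (by exact_mod_cast hdn)
  have hq' := hq.trans (Real.exp_le_exp.2 (show -ρ * Real.log ((2 ^ n : ℕ) : ℝ) ≤ -ρ * L by
    nlinarith))
  have hsx : ∑ k, x n k ^ 2 = 1 := by
    rw [← EuclideanSpace.real_norm_sq_eq, hx, one_pow]
  have hsy : ∑ k, y n k ^ 2 = 1 := by
    rw [← EuclideanSpace.real_norm_sq_eq, hy, one_pow]
  have hsxy : ∑ k, (x n k + y n k) ^ 2 = 2 * κ := by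
    have h1 := parallelogram_law_with_norm ℝ (x n) (y n)
    have h2 := EuclideanSpace.real_norm_sq_eq (x n + y n)
    simp only [PiLp.add_apply] at h2
    rw [← h2]
    rw [hx, hy, hxy] at h1
    rw [hκ]
    linarith
  obtain ⟨hlo, hhi⟩ := fastCollProb_bounds (N := d' n) hm hmd hsx hsy hsxy
    (by rw [hκ]; nlinarith) hT hmin.le (min_le_right _ _) hq' (Real.exp_pos _).le
    (Real.exp_pos _).le fun v w h1 h2 h3 => hc _ v w (h1.trans_le (min_le_left _ _))
      (h2.trans_le (min_le_left _ _)) (h3.trans_le (min_le_left _ _))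
  exact abs_log_inv_div_sub_lt hδ (by linarith) ((div_le_iff₀ hδ).1 hL1)
    ((div_le_iff₀ hρpos).1 hL2) hlo hhi

/-- Fast cross-polytope LSH has optimal asymptotic sensitivity (Theorem 3.1(i)): for
`0 < R < 2`, `c > 1`, `cR < 2`, there is `C > 0` such that with `d = 2^n`,
`m = ⌈C(ln d)⁵(ln ln d)⁴⌉`, and any lifts `m ≤ d' ≤ d`, for all sequences of unit vectors
at distances `R` and `cR`, the sensitivity exponent
`ρ_d = ln(1/Pr[h_F(x)=h_F(y)]) / ln(1/Pr[h_F(x')=h_F(y')])` tends to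
`(1/c²)·(4 − c²R²)/(4 − R²)`. -/
theorem stmt_0 (R c : ℝ) (hR : 0 < R) (hR2 : R < 2) (hc : 1 < c) (hcR : c * R < 2) :
    ∃ C : ℝ, 0 < C ∧
      ∀ (d' : ℕ → ℕ) (x y x' y' : (n : ℕ) → EuclideanSpace ℝ (Fin (2 ^ n))),
        (∀ᶠ n in atTop,
          emDim C (2 ^ n) ≤ d' n ∧ d' n ≤ 2 ^ n ∧
          ‖x n‖ = 1 ∧ ‖y n‖ = 1 ∧ ‖x n - y n‖ = R ∧
          ‖x' n‖ = 1 ∧ ‖y' n‖ = 1 ∧ ‖x' n - y' n‖ = c * R) →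
        Tendsto (fun n =>
            Real.log (1 / fastCollProb n (emDim C (2 ^ n)) (d' n)
                (fun i => x n i) (fun i => y n i)) /
              Real.log (1 / fastCollProb n (emDim C (2 ^ n)) (d' n)
                (fun i => x' n i) (fun i => y' n i)))
          atTop (nhds (1 / c ^ 2 * ((4 - c ^ 2 * R ^ 2) / (4 - R ^ 2)))) := by
  refine ⟨1, one_pos, fun d' x y x' y' h => ?_⟩
  have hR4 : 0 < 4 - R ^ 2 := by nlinarith
  have hcR0 : 0 < c * R := by positivity
  have hcR4 : 0 < 4 - (c * R) ^ 2 := by nlinarith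
  have h1 := fastCollProb_exponent hR hR2 d' x y
    (h.mono fun n hn => ⟨hn.1, hn.2.1, hn.2.2.1, hn.2.2.2.1, hn.2.2.2.2.1⟩)
  have h2 := fastCollProb_exponent hcR0 hcR d' x' y'
    (h.mono fun n hn => ⟨hn.1, hn.2.1, hn.2.2.2.2.2⟩)
  have h3 := h1.div h2 (by positivity)
  have e : R ^ 2 / (4 - R ^ 2) / ((c * R) ^ 2 / (4 - (c * R) ^ 2)) =
      1 / c ^ 2 * ((4 - c ^ 2 * R ^ 2) / (4 - R ^ 2)) := by
    rw [mul_pow] at hcR4 ⊢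
    field_simp
  rw [e] at h3
  refine h3.congr' ?_
  filter_upwards [h2.eventually_ne (show (c * R) ^ 2 / (4 - (c * R) ^ 2) ≠ 0 by positivity)]
    with n hn
  exact div_div_div_cancel_right₀ (div_ne_zero_iff.1 hn).2 _ _
end

section
/- Fix 0 < R < 2 and c > 1 with cR < 2. There exists a constant C > 0 such that for every d there are: a finite set Ω_d with cardinality |Ω_d| ≤ 2^{⌈C (ln d)^9⌉}, equipped with the uniform probability measure; a finite set F_d with |F_d| ≤ C (ln d)^4; and a family of functions (h_ω : S^{d−1} → F_d)_{ω ∈ Ω_d}, such that for any sequences of unit vectors x_d, y_d ∈ S^{d−1} with ‖x_d − y_d‖₂ = R and x'_d, y'_d ∈ S^{d−1} with ‖x'_d − y'_d‖₂ = cR, the sensitivity exponent ρ_d = ln(1/Pr_{ω}[h_ω(x_d) = h_ω(y_d)]) / ln(1/Pr_{ω}[h_ω(x'_d) = h_ω(y'_d)]) satisfies lim_{d→∞} ρ_d = (1/c²)·(4 − c²R²)/(4 − R²). (In other words, there is a hash family on S^{d−1} using O((ln d)^9) bits of randomness achieving the asymptotically optimal sensitivity exponent.) -/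
open Filter

/-- The collision probability of `v, w` under the hash family `(h ω)_{ω ∈ Fin N}` with the
uniform measure: the fraction of seeds `ω` for which `h ω v = h ω w`. -/
noncomputable def collisionFraction {N M : ℕ} {α : Type*}
    (h : Fin N → α → Fin M) (v w : α) : ℝ :=
  ((Finset.univ.filter fun ω : Fin N => h ω v = h ω w).card : ℝ) / N

section

open Finset

/-! ### Finite product measures -/

lemma sum_fin_succ_fun {A : Type*} [Fintype A] {n : ℕ} (F : (Fin (n + 1) → A) → ℝ) :
    ∑ ω, F ω = ∑ a, ∑ ω, F (Fin.cons a ω) := by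
  rw [← (Fin.consEquiv fun _ => A).sum_comp, Fintype.sum_prod_type]
  rfl

lemma sum_prod_weight {A : Type*} [Fintype A] {n : ℕ} (m : Fin n → A → ℝ)
    (hm : ∀ i, ∑ a, m i a = 1) : ∑ ω : Fin n → A, ∏ i, m i (ω i) = 1 := by
  classical
  rw [← Fintype.prod_sum]
  simp [hm]

/-- The variance of a sum of independent centred variables is the sum of their variances. -/
lemma sum_prod_weight_mul_sq {A : Type*} [Fintype A] {n : ℕ} (m f : Fin n → A → ℝ)
    (hm : ∀ i, ∑ a, m i a = 1) (hf : ∀ i, ∑ a, m i a * f i a = 0) :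
    ∑ ω : Fin n → A, (∏ i, m i (ω i)) * (∑ i, f i (ω i)) ^ 2
      = ∑ i, ∑ a, m i a * f i a ^ 2 := by
  induction n with
  | zero => simp
  | succ n ih =>
    have key : ∀ a, ∑ ω : Fin n → A, (∏ i, m i ((Fin.cons a ω : Fin (n + 1) → A) i)) *
          (∑ i, f i ((Fin.cons a ω : Fin (n + 1) → A) i)) ^ 2
        = m 0 a * f 0 a ^ 2
          + m 0 a * f 0 a * (2 * ∑ ω : Fin n → A, (∏ i : Fin n, m i.succ (ω i)) *
              ∑ i : Fin n, f i.succ (ω i))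
          + m 0 a * ∑ i : Fin n, ∑ a, m i.succ a * f i.succ a ^ 2 := by
      intro a
      rw [← ih (fun i => m i.succ) (fun i => f i.succ) (fun i => hm _) (fun i => hf _)]
      have h1 := sum_prod_weight (fun i : Fin n => m i.succ) (fun i => hm _)
      calc _ = ∑ ω : Fin n → A, (m 0 a * f 0 a ^ 2 * (∏ i : Fin n, m i.succ (ω i))
            + m 0 a * f 0 a * (2 * ((∏ i : Fin n, m i.succ (ω i)) *
              ∑ i : Fin n, f i.succ (ω i)))
            + m 0 a * ((∏ i : Fin n, m i.succ (ω i)) * (∑ i : Fin n, f i.succ (ω i)) ^ 2)) := by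
            refine Finset.sum_congr rfl fun ω _ => ?_
            simp only [Fin.prod_univ_succ, Fin.sum_univ_succ, Fin.cons_zero, Fin.cons_succ]
            ring
        _ = _ := by
            simp only [Finset.sum_add_distrib, ← Finset.mul_sum]
            rw [h1]
            ring
    rw [sum_fin_succ_fun, Finset.sum_congr rfl fun a _ => key a]
    simp only [Finset.sum_add_distrib, ← Finset.sum_mul]
    rw [hf, hm, Fin.sum_univ_succ]
    ring

/-! ### Uniform probabilities -/

open Classical in
/-- The uniform probability of `P` on a finite type. -/
noncomputable def unifProb {α : Type*} [Fintype α] (P : α → Prop) : ℝ :=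
  (∑ a, if P a then 1 else 0) / Fintype.card α

open Classical in
lemma unifProb_nonneg {α : Type*} [Fintype α] (P : α → Prop) : 0 ≤ unifProb P :=
  div_nonneg (Finset.sum_nonneg fun _ _ => by split_ifs <;> norm_num) (Nat.cast_nonneg _)

open Classical in
lemma unifProb_mono {α : Type*} [Fintype α] {P Q : α → Prop} (h : ∀ a, P a → Q a) :
    unifProb P ≤ unifProb Q := by
  unfold unifProb
  gcongr with a
  split_ifs with h1 h2
  · exact le_rfl
  · exact absurd (h a h1) h2
  · exact zero_le_one
  · exact le_rfl

lemma unifProb_true {α : Type*} [Fintype α] [Nonempty α] {P : α → Prop} (h : ∀ a, P a) :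
    unifProb P = 1 := by
  simp [unifProb, h]

lemma unifProb_le_one {α : Type*} [Fintype α] [Nonempty α] (P : α → Prop) : unifProb P ≤ 1 :=
  (unifProb_mono (Q := fun _ => True) fun _ _ => trivial).trans_eq (unifProb_true fun _ => trivial)

open Classical in
lemma unifProb_or_le {α : Type*} [Fintype α] (P Q : α → Prop) :
    unifProb (fun a => P a ∨ Q a) ≤ unifProb P + unifProb Q := by
  unfold unifProb
  rw [← add_div, ← Finset.sum_add_distrib]
  gcongr with a
  by_cases h1 : P a <;> by_cases h2 : Q a <;> simp [h1, h2]

/-- Markov's inequality on a finite uniform space. -/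
lemma unifProb_le_of_indicator_le {α : Type*} [Fintype α] {P : α → Prop} {F : α → ℝ}
    (h0 : ∀ a, 0 ≤ F a) (h1 : ∀ a, P a → 1 ≤ F a) :
    unifProb P ≤ (∑ a, F a) / Fintype.card α := by
  classical
  unfold unifProb
  gcongr with a
  split_ifs with h
  · exact h1 a h
  · exact h0 a

lemma unifProb_prod {α β : Type*} [Fintype α] [Fintype β] (P : α × β → Prop) :
    unifProb P = (∑ a, unifProb fun b => P (a, b)) / Fintype.card α := by
  classical
  unfold unifProb
  rw [Fintype.sum_prod_type, ← Finset.sum_div, div_div, Fintype.card_prod, Nat.cast_mul, mul_comm]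

lemma unifProb_prod_le {α β : Type*} [Fintype α] [Nonempty α] [Fintype β] [Nonempty β]
    (P : α × β → Prop) (B : α → Prop) {δ b : ℝ} (hb : 0 ≤ b) (hB : unifProb B ≤ δ)
    (h : ∀ a, ¬ B a → unifProb (fun b => P (a, b)) ≤ b) : unifProb P ≤ δ + b := by
  classical
  have hc : (0 : ℝ) < Fintype.card α := by exact_mod_cast Fintype.card_pos
  rw [unifProb_prod]
  have : ∀ a, unifProb (fun b => P (a, b)) ≤ (if B a then 1 else 0) + b := by
    intro a
    split_ifs with ha
    · linarith [unifProb_le_one fun b => P (a, b)]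
    · linarith [h a ha]
  calc _ ≤ (∑ a, ((if B a then 1 else 0) + b)) / (Fintype.card α : ℝ) := by
        gcongr with a; exact this a
    _ = unifProb B + b := by
        rw [Finset.sum_add_distrib, add_div, unifProb]
        simp
    _ ≤ δ + b := by linarith

lemma le_unifProb_prod {α β : Type*} [Fintype α] [Nonempty α] [Fintype β]
    (P : α × β → Prop) (B : α → Prop) {δ b : ℝ} (hb : 0 ≤ b) (hB : unifProb B ≤ δ)
    (h : ∀ a, ¬ B a → b ≤ unifProb (fun b => P (a, b))) : (1 - δ) * b ≤ unifProb P := by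
  classical
  have hc : (0 : ℝ) < Fintype.card α := by exact_mod_cast Fintype.card_pos
  rw [unifProb_prod]
  have : ∀ a, b - b * (if B a then 1 else 0) ≤ unifProb (fun b => P (a, b)) := by
    intro a
    split_ifs with ha
    · linarith [unifProb_nonneg fun b => P (a, b)]
    · linarith [h a ha]
  calc (1 - δ) * b ≤ (1 - unifProb B) * b := by gcongr
    _ = (∑ a, (b - b * (if B a then 1 else 0))) / (Fintype.card α : ℝ) := by
        rw [Finset.sum_sub_distrib, ← Finset.mul_sum, unifProb]
        simp; field_simp
    _ ≤ _ := by gcongr with a; exact this a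

lemma unifProb_comp_equiv {α β : Type*} [Fintype α] [Fintype β] (e : α ≃ β) (P : β → Prop) :
    unifProb (fun a => P (e a)) = unifProb P := by
  classical
  unfold unifProb
  rw [e.sum_comp (fun b => if P b then (1 : ℝ) else 0), Fintype.card_congr e]

lemma collisionFraction_eq_unifProb {N M : ℕ} {α : Type*} (h : Fin N → α → Fin M) (v w : α) :
    collisionFraction h v w = unifProb fun ω => h ω v = h ω w := by
  classical
  rw [collisionFraction, unifProb, Fintype.card_fin, Finset.card_filter, Nat.cast_sum]
  congr! 2
  simp

/-! ### First-hit hashing -/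

open Classical in
/-- The least index satisfying `P`, or `T` if there is none. -/
noncomputable def firstHit : (T : ℕ) → (Fin T → Prop) → Fin (T + 1)
  | 0, _ => 0
  | T + 1, P => if P 0 then 0 else (firstHit T fun i => P i.succ).succ

lemma unifProb_firstHit_succ {G : Type*} [Fintype G] [Nonempty G] (A B : G → Prop) (T : ℕ) :
    unifProb (fun ω : Fin (T + 1) → G =>
        firstHit (T + 1) (fun i => A (ω i)) = firstHit (T + 1) fun i => B (ω i))
      = unifProb (fun g => A g ∧ B g) + (1 - unifProb fun g => A g ∨ B g) *
        unifProb (fun ω : Fin T → G =>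
          firstHit T (fun i => A (ω i)) = firstHit T fun i => B (ω i)) := by
  classical
  have hc : (Fintype.card G : ℝ) ≠ 0 := by exact_mod_cast Fintype.card_ne_zero
  have key : ∀ (g : G) (ω : Fin T → G),
      (if firstHit (T + 1) (fun i => A ((Fin.cons g ω : Fin (T + 1) → G) i))
          = firstHit (T + 1) (fun i => B ((Fin.cons g ω : Fin (T + 1) → G) i)) then (1 : ℝ) else 0)
        = (if A g ∧ B g then 1 else 0) + (1 - if A g ∨ B g then 1 else 0) *
          (if firstHit T (fun i => A (ω i)) = firstHit T fun i => B (ω i) then 1 else 0) := by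
    intro g ω
    by_cases hA : A g <;> by_cases hB : B g <;>
      simp [firstHit, hA, hB, Fin.succ_ne_zero, (Fin.succ_ne_zero _).symm]
  unfold unifProb
  rw [sum_fin_succ_fun, Finset.sum_congr rfl fun g _ => Finset.sum_congr rfl fun ω _ =>
    (by convert key g ω : _ = _)]
  simp only [Finset.sum_add_distrib, ← Finset.mul_sum, ← Finset.sum_mul, Finset.sum_sub_distrib]
  simp only [Finset.sum_const, Finset.card_univ, Fintype.card_fun, Fintype.card_fin, nsmul_eq_mul,
    Nat.cast_pow, ← Finset.mul_sum]
  field_simp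
  rw [pow_succ]
  congr!

lemma unifProb_firstHit {G : Type*} [Fintype G] [Nonempty G] (A B : G → Prop) (T : ℕ) {p q : ℝ}
    (hp : unifProb (fun g => A g ∧ B g) = p) (hq : unifProb (fun g => A g ∨ B g) = q)
    (hq0 : q ≠ 0) :
    unifProb (fun ω : Fin T → G => firstHit T (fun i => A (ω i)) = firstHit T fun i => B (ω i))
      = p / q + (1 - q) ^ T * (1 - p / q) := by
  induction T with
  | zero => rw [unifProb_true (fun _ => by rfl)]; ring
  | succ T ih => rw [unifProb_firstHit_succ, ih, hp, hq]; field_simp; ring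

/-! ### Rademacher sums -/

/-- The sign `±1` encoded by a bit. -/
def boolSign (b : Bool) : ℝ := if b then 1 else -1

/-- The signed sum `∑ εᵢ uᵢ`. -/
noncomputable def signedSum {m : ℕ} (u : Fin m → ℝ) (ε : Fin m → Bool) : ℝ :=
  ∑ i, u i * boolSign (ε i)

lemma signedSum_add {m : ℕ} (u v : Fin m → ℝ) (ε : Fin m → Bool) :
    signedSum (fun i => u i + v i) ε = signedSum u ε + signedSum v ε := by
  simp [signedSum, add_mul, Finset.sum_add_distrib]

lemma sum_exp_signedSum_le {m : ℕ} (w : Fin m → ℝ) (l : ℝ) :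
    (∑ ε : Fin m → Bool, Real.exp (l * signedSum w ε)) / Fintype.card (Fin m → Bool)
      ≤ Real.exp (l ^ 2 * (∑ i, w i ^ 2) / 2) := by
  have h1 : ∑ ε : Fin m → Bool, Real.exp (l * signedSum w ε)
      = ∏ i, ∑ b : Bool, Real.exp (l * (w i * boolSign b)) := by
    rw [Fintype.prod_sum]
    refine Finset.sum_congr rfl fun ε _ => ?_
    rw [signedSum, Finset.mul_sum, Real.exp_sum]
  have h2 : ∀ i, ∑ b : Bool, Real.exp (l * (w i * boolSign b)) = 2 * Real.cosh (l * w i) := by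
    intro i
    rw [Fintype.sum_bool, Real.cosh_eq]
    simp only [boolSign, if_true, Bool.false_eq_true, if_false, mul_one, mul_neg]
    ring
  have h3 : (Fintype.card (Fin m → Bool) : ℝ) = 2 ^ m := by simp
  rw [h1, h3, Finset.prod_congr rfl fun i _ => h2 i, Finset.prod_mul_distrib]
  simp only [Finset.prod_const, Finset.card_univ, Fintype.card_fin]
  rw [mul_div_cancel_left₀ _ (by positivity)]
  calc ∏ i, Real.cosh (l * w i) ≤ ∏ i, Real.exp ((l * w i) ^ 2 / 2) :=
        Finset.prod_le_prod (fun i _ => (Real.cosh_pos _).le)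
          fun i _ => Real.cosh_le_exp_half_sq _
    _ = _ := by
        rw [← Real.exp_sum]
        congr 1
        rw [← Finset.sum_div, Finset.mul_sum]
        congr 1
        exact Finset.sum_congr rfl fun i _ => by ring

lemma unifProb_signedSum_ge_le {m : ℕ} (u v : Fin m → ℝ) {t l : ℝ} (hl : 0 ≤ l) :
    unifProb (fun ε => t ≤ signedSum u ε ∧ t ≤ signedSum v ε)
      ≤ Real.exp (l ^ 2 * (∑ i, (u i + v i) ^ 2) / 2 - 2 * l * t) := by
  refine (unifProb_le_of_indicator_le
    (F := fun ε => Real.exp (l * signedSum (fun i => u i + v i) ε) * Real.exp (- (2 * l * t)))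
    (fun _ => by positivity) ?_).trans ?_
  · rintro ε ⟨h1, h2⟩
    rw [← Real.exp_add]
    refine Real.one_le_exp ?_
    rw [signedSum_add]
    nlinarith
  · rw [← Finset.sum_mul, mul_div_right_comm, sub_eq_add_neg, Real.exp_add]
    gcongr
    exact sum_exp_signedSum_le _ _

lemma one_add_le_exp_cubic {z : ℝ} (hz : |z| ≤ 1 / 2) :
    1 + z ≤ Real.exp (z - z ^ 2 / 2 + 2 * |z| ^ 3) := by
  have h := Real.abs_log_sub_add_sum_range_le (x := -z) (by rw [abs_neg]; linarith) 2
  simp only [Finset.sum_range_succ, Finset.sum_range_zero, abs_neg] at h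
  have hz' := abs_le.mp hz
  have h2 : |z| ^ (2 + 1) / (1 - |z|) ≤ 2 * |z| ^ 3 := by
    rw [div_le_iff₀ (by linarith)]
    have : 0 ≤ |z| ^ 3 := by positivity
    norm_num
    nlinarith
  have h3 := (abs_le.mp (h.trans h2)).2
  norm_num at h3
  rw [← Real.exp_log (show 0 < 1 + z by linarith)]
  apply Real.exp_le_exp.mpr
  linarith

/-- Lower bound for the uniform measure in terms of the tilted product measure. -/
lemma le_unifProb_signedSum_ge {m : ℕ} (u v : Fin m → ℝ) {t l : ℝ} (hl : 0 ≤ l)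
    (ha : ∀ i, |l * (u i + v i)| ≤ 1 / 2) (hc : 2 * ∑ i, |l * (u i + v i)| ^ 3 ≤ 1)
    (hu : ∑ i, u i ^ 2 ≤ 11 / 10) (hv : ∑ i, v i ^ 2 ≤ 11 / 10)
    (hmu : |l * ∑ i, u i * (u i + v i) - (t + 3)| ≤ 1)
    (hmv : |l * ∑ i, v i * (u i + v i) - (t + 3)| ≤ 1) :
    Real.exp (l ^ 2 * (∑ i, (u i + v i) ^ 2) / 2 - l * (2 * t + 12) - 2)
      ≤ unifProb (fun ε => t ≤ signedSum u ε ∧ t ≤ signedSum v ε) := by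
  classical
  set a : Fin m → ℝ := fun i => l * (u i + v i) with ha_def
  set W : (Fin m → Bool) → ℝ := fun ε => ∏ i, (1 + a i * boolSign (ε i)) / 2 with hW
  have hsq : ∀ b, boolSign b ^ 2 = 1 := by intro b; cases b <;> simp [boolSign]
  have habs : ∀ b, |boolSign b| = 1 := by intro b; cases b <;> simp [boolSign]
  have hpos : ∀ i b, 0 < 1 + a i * boolSign b := by
    intro i b
    have h1 : |a i * boolSign b| ≤ 1 / 2 := by rw [abs_mul, habs, mul_one]; exact ha i
    linarith [(abs_le.mp h1).1]
  have hWnn : ∀ ε, 0 ≤ W ε := fun ε =>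
    Finset.prod_nonneg fun i _ => div_nonneg (hpos _ _).le zero_le_two
  have hm1 : ∀ i, ∑ b : Bool, (1 + a i * boolSign b) / 2 = 1 := by
    intro i; rw [Fintype.sum_bool]; simp [boolSign]; ring
  have hW1 : ∑ ε, W ε = 1 := sum_prod_weight (fun i b => (1 + a i * boolSign b) / 2) hm1
  have hvar : ∀ x : Fin m → ℝ,
      ∑ ε, W ε * (signedSum x ε - ∑ i, x i * a i) ^ 2 ≤ ∑ i, x i ^ 2 := by
    intro x
    have := sum_prod_weight_mul_sq (fun i b => (1 + a i * boolSign b) / 2)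
      (fun i b => x i * (boolSign b - a i)) hm1
      (by intro i; rw [Fintype.sum_bool]; simp [boolSign]; ring)
    calc _ = ∑ i, ∑ b : Bool, (1 + a i * boolSign b) / 2 * (x i * (boolSign b - a i)) ^ 2 := by
          rw [← this]
          refine Finset.sum_congr rfl fun ε _ => ?_
          simp only [hW, signedSum, mul_sub, Finset.sum_sub_distrib]
      _ ≤ _ := by
          refine Finset.sum_le_sum fun i _ => ?_
          rw [Fintype.sum_bool]
          simp only [boolSign, if_true, Bool.false_eq_true, if_false]
          nlinarith [mul_nonneg (sq_nonneg (x i)) (sq_nonneg (a i))]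
  have hWle : ∀ ε, W ε ≤ (1 / 2) ^ m * Real.exp (l * (signedSum u ε + signedSum v ε)
      - l ^ 2 * (∑ i, (u i + v i) ^ 2) / 2 + 1) := by
    intro ε
    have : ∀ i, (1 + a i * boolSign (ε i)) / 2
        ≤ 1 / 2 * Real.exp (a i * boolSign (ε i) - a i ^ 2 / 2 + 2 * |a i| ^ 3) := by
      intro i
      have h1 : |a i * boolSign (ε i)| = |a i| := by rw [abs_mul, habs, mul_one]
      have h2 := one_add_le_exp_cubic (z := a i * boolSign (ε i)) (by rw [h1]; exact ha i)
      rw [h1, mul_pow, hsq, mul_one] at h2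
      linarith
    calc W ε ≤ ∏ i, (1 / 2 * Real.exp (a i * boolSign (ε i) - a i ^ 2 / 2 + 2 * |a i| ^ 3)) :=
          Finset.prod_le_prod (fun i _ => div_nonneg (hpos _ _).le zero_le_two) fun i _ => this i
      _ = (1 / 2) ^ m * Real.exp (∑ i, (a i * boolSign (ε i) - a i ^ 2 / 2 + 2 * |a i| ^ 3)) := by
          rw [Finset.prod_mul_distrib, Real.exp_sum]; simp
      _ ≤ _ := by
          gcongr
          rw [Finset.sum_add_distrib, Finset.sum_sub_distrib, ← Finset.mul_sum, ← Finset.sum_div]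
          have e1 : ∑ i, a i * boolSign (ε i) = l * (signedSum u ε + signedSum v ε) := by
            rw [← signedSum_add, signedSum, Finset.mul_sum]
            exact Finset.sum_congr rfl fun i _ => by simp only [ha_def]; ring
          have e2 : ∑ i, a i ^ 2 = l ^ 2 * ∑ i, (u i + v i) ^ 2 := by
            rw [Finset.mul_sum]
            exact Finset.sum_congr rfl fun i _ => by simp only [ha_def]; ring
          rw [e1, e2]
          linarith
  have hmean : ∀ x : Fin m → ℝ, ∑ i, x i * a i = l * ∑ i, x i * (u i + v i) := by
    intro x
    rw [Finset.mul_sum]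
    exact Finset.sum_congr rfl fun i _ => by simp only [ha_def]; ring
  set L := Real.exp (l ^ 2 * (∑ i, (u i + v i) ^ 2) / 2 - l * (2 * t + 12) - 1) with hL
  have hpt : ∀ ε, L * (W ε - W ε * (signedSum u ε - ∑ i, u i * a i) ^ 2 / 4
        - W ε * (signedSum v ε - ∑ i, v i * a i) ^ 2 / 4)
      ≤ (if t ≤ signedSum u ε ∧ t ≤ signedSum v ε then 1 else 0) * (1 / 2) ^ m := by
    intro ε
    set X := signedSum u ε - ∑ i, u i * a i with hX
    set Y := signedSum v ε - ∑ i, v i * a i with hY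
    have hLpos : 0 < L := Real.exp_pos _
    by_cases hbig : X ^ 2 ≤ 4 ∧ Y ^ 2 ≤ 4
    · have hX2 := abs_le.mp (abs_le_of_sq_le_sq (by linarith [hbig.1] : X ^ 2 ≤ 2 ^ 2) zero_le_two)
      have hY2 := abs_le.mp (abs_le_of_sq_le_sq (by linarith [hbig.2] : Y ^ 2 ≤ 2 ^ 2) zero_le_two)
      rw [hX, hmean] at hX2
      rw [hY, hmean] at hY2
      have h3 := abs_le.mp hmu
      have h4 := abs_le.mp hmv
      rw [if_pos ⟨by linarith, by linarith⟩, one_mul]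
      calc _ ≤ L * W ε := by
            gcongr
            nlinarith [mul_nonneg (hWnn ε) (sq_nonneg X), mul_nonneg (hWnn ε) (sq_nonneg Y)]
        _ ≤ L * ((1 / 2) ^ m * Real.exp (l * (2 * t + 12)
              - l ^ 2 * (∑ i, (u i + v i) ^ 2) / 2 + 1)) := by
            gcongr
            refine (hWle ε).trans
              (mul_le_mul_of_nonneg_left (Real.exp_le_exp.mpr ?_) (by positivity))
            have : l * (signedSum u ε + signedSum v ε) ≤ l * (2 * t + 12) :=
              mul_le_mul_of_nonneg_left (by linarith) hl
            linarith
        _ = (1 / 2) ^ m * (L * Real.exp (l * (2 * t + 12)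
              - l ^ 2 * (∑ i, (u i + v i) ^ 2) / 2 + 1)) := by ring
        _ = (1 / 2) ^ m := by
            rw [hL, ← Real.exp_add]
            ring_nf
            simp
    · have h0 : (0 : ℝ) ≤
          (if t ≤ signedSum u ε ∧ t ≤ signedSum v ε then 1 else 0) * (1 / 2) ^ m := by
        split_ifs <;> positivity
      refine le_trans ?_ h0
      refine mul_nonpos_of_nonneg_of_nonpos hLpos.le ?_
      have : 4 ≤ X ^ 2 + Y ^ 2 := by
        by_contra hcon
        push Not at hcon
        exact hbig ⟨by nlinarith [sq_nonneg Y], by nlinarith [sq_nonneg X]⟩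
      nlinarith [hWnn ε]
  have hcard : (Fintype.card (Fin m → Bool) : ℝ) = 2 ^ m := by simp
  have hsum := Finset.sum_le_sum fun ε (_ : ε ∈ (Finset.univ : Finset (Fin m → Bool))) => hpt ε
  rw [← Finset.mul_sum, ← Finset.sum_mul, Finset.sum_sub_distrib, Finset.sum_sub_distrib,
    ← Finset.sum_div, ← Finset.sum_div, hW1] at hsum
  calc _ = L * Real.exp (-1) := by rw [hL, ← Real.exp_add]; ring_nf
    _ ≤ L * (45 / 100) := by
        have hLpos : 0 < L := Real.exp_pos _
        gcongr
        linarith [Real.exp_neg_one_lt_d9]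
    _ ≤ L * (1 - (∑ ε, W ε * (signedSum u ε - ∑ i, u i * a i) ^ 2) / 4
        - (∑ ε, W ε * (signedSum v ε - ∑ i, v i * a i) ^ 2) / 4) := by
        have hLpos : 0 < L := Real.exp_pos _
        gcongr
        linarith [hvar u, hvar v]
    _ ≤ _ := hsum
    _ = _ := by
        rw [unifProb, hcard, one_div, inv_pow, div_eq_mul_inv]
        congr!

/-- `u` and `v` are nearly unit vectors whose inner product is nearly `s`. -/
def NearGram {ι : Type*} [Fintype ι] (κ s : ℝ) (u v : ι → ℝ) : Prop :=
  |∑ i, u i ^ 2 - 1| ≤ κ ∧ |∑ i, v i ^ 2 - 1| ≤ κ ∧ |∑ i, u i * v i - s| ≤ κ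

/-- Logarithmic error allowed at threshold `t`, for `1` plus the inner product at least `b`. -/
noncomputable def logError (b t : ℝ) : ℝ := (12 * t + 27) / b + 3

lemma logError_ge {b t : ℝ} (hb : 0 < b) (ht : 0 ≤ t) : 3 ≤ logError b t := by
  have : 0 ≤ (12 * t + 27) / b := by positivity
  unfold logError; linarith

lemma exists_unifProb_signedSum_bounds {b t : ℝ} (hb : 0 < b) (ht : 0 ≤ t) :
    ∃ κ > 0, κ ≤ 1 ∧ ∃ η > 0, ∀ β, b ≤ β → ∀ (m : ℕ) (u v : Fin m → ℝ),
      NearGram κ (β - 1) u v → (∀ i, |u i| ≤ η) → (∀ i, |v i| ≤ η) →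
      Real.exp (-t ^ 2 / β - logError b t)
          ≤ unifProb (fun ε => t ≤ signedSum u ε ∧ t ≤ signedSum v ε) ∧
        unifProb (fun ε => t ≤ signedSum u ε ∧ t ≤ signedSum v ε)
          ≤ Real.exp (-t ^ 2 / β + 1) := by
  set K := (t + 3) / b with hK
  have hK0 : 0 < K := by positivity
  refine ⟨1 / (10 * (1 + K) ^ 2), by positivity, ?_, 1 / (100 * (1 + K) ^ 3), by positivity, ?_⟩
  · rw [div_le_one (by positivity)]; nlinarith
  intro β hβ m u v ⟨hu, hv, huv⟩ hu' hv'
  set κ := 1 / (10 * (1 + K) ^ 2) with hκ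
  set η := 1 / (100 * (1 + K) ^ 3) with hη
  have hκ0 : 0 < κ := by positivity
  have hη0 : 0 < η := by positivity
  have hκe : κ * (10 * (1 + K) ^ 2) = 1 := by rw [hκ]; field_simp
  have hηe : η * (100 * (1 + K) ^ 3) = 1 := by rw [hη]; field_simp
  have hκ1 : κ ≤ 1 / 10 := by nlinarith [mul_pos hκ0 hK0, mul_pos hκ0 (pow_pos hK0 2)]
  have hκK : 2 * κ * K ≤ 1 := by nlinarith [mul_pos hκ0 hK0, mul_pos hκ0 (pow_pos hK0 2)]
  have hκK2 : 2 * κ * K ^ 2 ≤ 1 := by nlinarith [mul_pos hκ0 hK0, mul_pos hκ0 (pow_pos hK0 2)]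
  have hηK : 2 * η * K ≤ 1 / 2 := by
    nlinarith [mul_pos hη0 hK0, mul_pos hη0 (pow_pos hK0 2), mul_pos hη0 (pow_pos hK0 3)]
  have hηK3 : 20 * η * K ^ 3 ≤ 1 := by
    nlinarith [mul_pos hη0 hK0, mul_pos hη0 (pow_pos hK0 2), mul_pos hη0 (pow_pos hK0 3)]
  have hβ0 : 0 < β := hb.trans_le hβ
  have hw : ∑ i, (u i + v i) ^ 2 = ∑ i, u i ^ 2 + ∑ i, v i ^ 2 + 2 * ∑ i, u i * v i := by
    rw [Finset.mul_sum, ← Finset.sum_add_distrib, ← Finset.sum_add_distrib]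
    exact Finset.sum_congr rfl fun i _ => by ring
  have huw : ∑ i, u i * (u i + v i) = ∑ i, u i ^ 2 + ∑ i, u i * v i := by
    rw [← Finset.sum_add_distrib]
    exact Finset.sum_congr rfl fun i _ => by ring
  have hvw : ∑ i, v i * (u i + v i) = ∑ i, v i ^ 2 + ∑ i, u i * v i := by
    rw [← Finset.sum_add_distrib]
    exact Finset.sum_congr rfl fun i _ => by ring
  obtain ⟨hu1, hu2⟩ := abs_le.mp hu
  obtain ⟨hv1, hv2⟩ := abs_le.mp hv
  obtain ⟨huv1, huv2⟩ := abs_le.mp huv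
  constructor
  · set l := (t + 3) / β with hl
    have hl0 : 0 < l := by positivity
    have hlK : l ≤ K := by rw [hl, hK]; gcongr
    have hlβ : l * β = t + 3 := by rw [hl]; field_simp
    have hai : ∀ i, |l * (u i + v i)| ≤ 2 * η * K := by
      intro i
      rw [abs_mul, abs_of_pos hl0]
      calc l * |u i + v i| ≤ K * (η + η) := by
            gcongr
            exact (abs_add_le _ _).trans (add_le_add (hu' i) (hv' i))
        _ = _ := by ring
    refine le_trans ?_ (le_unifProb_signedSum_ge u v (t := t) hl0.le (fun i => (hai i).trans hηK)
      ?_ (by linarith) (by linarith) ?_ ?_)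
    · apply Real.exp_le_exp.mpr
      have h1 : 2 * κ * l ^ 2 ≤ 1 := le_trans (by gcongr) hκK2
      have h2 : (12 * t + 27) / β ≤ (12 * t + 27) / b := by gcongr
      have h3 : l ^ 2 * (2 * β - 4 * κ) ≤ l ^ 2 * ∑ i, (u i + v i) ^ 2 := by
        gcongr
        rw [hw]; linarith
      have h4 : l ^ 2 * (2 * β - 4 * κ) = 2 * ((t + 3) ^ 2 / β) - 2 * (2 * κ * l ^ 2) := by
        rw [hl]; field_simp; ring
      have h5 : l * (2 * t + 12) = (t + 3) * (2 * t + 12) / β := by rw [hl]; ring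
      have h6 : -t ^ 2 / β - (12 * t + 27) / β
          = (t + 3) ^ 2 / β - (t + 3) * (2 * t + 12) / β := by field_simp; ring
      unfold logError
      linarith
    · calc 2 * ∑ i, |l * (u i + v i)| ^ 3
          ≤ 2 * ∑ i, (2 * η * K) * (l ^ 2 * (u i + v i) ^ 2) := by
            gcongr with i
            calc |l * (u i + v i)| ^ 3 = |l * (u i + v i)| * |l * (u i + v i)| ^ 2 := by ring
              _ ≤ (2 * η * K) * |l * (u i + v i)| ^ 2 := by gcongr; exact hai i
              _ = _ := by rw [sq_abs]; ring
        _ = (4 * η * K) * (l ^ 2 * ∑ i, (u i + v i) ^ 2) := by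
            rw [← Finset.mul_sum, ← Finset.mul_sum]; ring
        _ ≤ (4 * η * K) * (K ^ 2 * 5) := by
            gcongr
            have : ∑ i, (u i + v i) ^ 2 ≤ 2 * ∑ i, u i ^ 2 + 2 * ∑ i, v i ^ 2 := by
              rw [Finset.mul_sum, Finset.mul_sum, ← Finset.sum_add_distrib]
              exact Finset.sum_le_sum fun i _ => by nlinarith [sq_nonneg (u i - v i)]
            linarith
        _ = 20 * η * K ^ 3 := by ring
        _ ≤ 1 := hηK3
    all_goals
      first | rw [huw] | rw [hvw]
      rw [← hlβ, ← mul_sub, abs_mul, abs_of_pos hl0]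
      calc _ ≤ K * (2 * κ) := by
            gcongr
            exact abs_le.mpr ⟨by linarith, by linarith⟩
        _ = 2 * κ * K := by ring
        _ ≤ 1 := hκK
  · set l := t / β with hl
    have hl0 : 0 ≤ l := by positivity
    have hlK : l ≤ K := by rw [hl, hK]; gcongr; linarith
    refine (unifProb_signedSum_ge_le u v hl0).trans (Real.exp_le_exp.mpr ?_)
    have h1 : 2 * κ * l ^ 2 ≤ 1 := le_trans (by gcongr) hκK2
    have h3 : l ^ 2 * ∑ i, (u i + v i) ^ 2 ≤ l ^ 2 * (2 * β + 4 * κ) := by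
      gcongr
      rw [hw]; linarith
    have h4 : l ^ 2 * (2 * β + 4 * κ) / 2 - 2 * l * t = -t ^ 2 / β + 2 * κ * l ^ 2 := by
      rw [hl]; field_simp; ring
    linarith

/-- Collision probability of the first-hit hash of two fixed well-spread vectors. -/
lemma exists_firstHit_bounds {b t : ℝ} (hb : 0 < b) (hb2 : b ≤ 2) (ht : 0 ≤ t) :
    ∃ κ > 0, κ ≤ 1 ∧ ∃ η > 0, ∃ T : ℕ, ∀ β, b ≤ β → ∀ (m : ℕ) (u v : Fin m → ℝ),
      NearGram κ (β - 1) u v → (∀ i, |u i| ≤ η) → (∀ i, |v i| ≤ η) →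
      Real.exp (-t ^ 2 * (1 / β - 1 / 2) - logError b t - 2)
          ≤ unifProb (fun ω : Fin T → Fin m → Bool =>
            firstHit T (fun i => t ≤ signedSum u (ω i))
              = firstHit T fun i => t ≤ signedSum v (ω i)) ∧
        unifProb (fun ω : Fin T → Fin m → Bool =>
            firstHit T (fun i => t ≤ signedSum u (ω i))
              = firstHit T fun i => t ≤ signedSum v (ω i))
          ≤ 2 * Real.exp (-t ^ 2 * (1 / β - 1 / 2) + logError b t + 1) := by
  obtain ⟨κ, hκ, hκ1, η, hη, H⟩ := exists_unifProb_signedSum_bounds hb ht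
  set q₀ := Real.exp (-t ^ 2 / 2 - logError b t) with hq₀
  have hD := logError_ge hb ht
  have hq₀1 : q₀ < 1 := by
    rw [hq₀, Real.exp_lt_one_iff]; nlinarith [sq_nonneg t]
  have hq₀0 : 0 < q₀ := Real.exp_pos _
  obtain ⟨T, hT⟩ := exists_pow_lt_of_lt_one (Real.exp_pos (-t ^ 2 / b - logError b t))
    (show 1 - q₀ < 1 by linarith)
  refine ⟨κ, hκ, hκ1, η, hη, T, ?_⟩
  intro β hβ m u v hg hu hv
  have hβ0 : 0 < β := hb.trans_le hβ
  obtain ⟨hp1, hp2⟩ := H β hβ m u v hg hu hv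
  have huu : NearGram κ (2 - 1) u u :=
    ⟨hg.1, hg.1, by convert hg.1 using 3 <;> norm_num [pow_two]⟩
  have hvv : NearGram κ (2 - 1) v v :=
    ⟨hg.2.1, hg.2.1, by convert hg.2.1 using 3 <;> norm_num [pow_two]⟩
  obtain ⟨ha1, ha2⟩ := H 2 hb2 m u u huu hu hu
  obtain ⟨-, hb2'⟩ := H 2 hb2 m v v hvv hv hv
  simp only [and_self] at ha1 ha2 hb2'
  set p := unifProb (fun ε => t ≤ signedSum u ε ∧ t ≤ signedSum v ε) with hp
  set q := unifProb (fun ε => t ≤ signedSum u ε ∨ t ≤ signedSum v ε) with hq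
  have hq_lo : q₀ ≤ q := ha1.trans (unifProb_mono fun _ h => Or.inl h)
  have hq_hi : q ≤ Real.exp (-t ^ 2 / 2 + 2) := by
    calc q ≤ 2 * Real.exp (-t ^ 2 / 2 + 1) := by
          linarith [unifProb_or_le (fun ε => t ≤ signedSum u ε) fun ε => t ≤ signedSum v ε]
      _ ≤ Real.exp 1 * Real.exp (-t ^ 2 / 2 + 1) := by
          gcongr; linarith [Real.add_one_le_exp 1]
      _ = _ := by rw [← Real.exp_add]; ring_nf
  have hq1 : q ≤ 1 := unifProb_le_one _
  have hq0 : 0 < q := hq₀0.trans_le hq_lo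
  have hpq : p ≤ q := unifProb_mono fun _ h => Or.inl h.1
  have hp0 : 0 ≤ p := unifProb_nonneg _
  rw [unifProb_firstHit _ _ T hp.symm hq.symm hq0.ne']
  have hpq1 : p / q ≤ 1 := (div_le_one hq0).mpr hpq
  have hpq0 : 0 ≤ p / q := by positivity
  have hpow0 : 0 ≤ (1 - q) ^ T := pow_nonneg (by linarith) _
  have e1 : -t ^ 2 * (1 / β - 1 / 2) = -t ^ 2 / β - -t ^ 2 / 2 := by ring
  rw [e1]
  constructor
  · calc _ = Real.exp (-t ^ 2 / β - logError b t) / Real.exp (-t ^ 2 / 2 + 2) := by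
          rw [← Real.exp_sub]; ring_nf
      _ ≤ p / q := by gcongr
      _ ≤ _ := by nlinarith
  · have h1 : p / q ≤ Real.exp (-t ^ 2 / β - -t ^ 2 / 2 + logError b t + 1) := by
      calc p / q ≤ Real.exp (-t ^ 2 / β + 1) / q₀ := by gcongr
        _ = _ := by rw [hq₀, ← Real.exp_sub]; ring_nf
    have h2 : (1 - q) ^ T ≤ Real.exp (-t ^ 2 / β - -t ^ 2 / 2 + logError b t + 1) := by
      calc (1 - q) ^ T ≤ (1 - q₀) ^ T := by
            gcongr
        _ ≤ Real.exp (-t ^ 2 / b - logError b t) := hT.le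
        _ ≤ _ := by
            apply Real.exp_le_exp.mpr
            have : t ^ 2 / β ≤ t ^ 2 / b := by gcongr
            rw [neg_div, neg_div, neg_div]
            nlinarith [sq_nonneg t]
    nlinarith

/-! ### Random characters on a Sidon set -/

open scoped ComplexConjugate

lemma sum_addChar_mul_conj {G J : Type*} [AddCommGroup G] [Fintype G] [DecidableEq G] [Fintype J]
    (φ : J → G) (c c' : J → ℝ) :
    ∑ ψ : AddChar G ℂ, (∑ j, (c j : ℂ) * ψ (φ j)) * conj (∑ j, (c' j : ℂ) * ψ (φ j))
      = ((Fintype.card G * ∑ j, ∑ l, if φ j = φ l then c j * c' l else 0 : ℝ) : ℂ) := by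
  have h : ∀ ψ : AddChar G ℂ,
      (∑ j, (c j : ℂ) * ψ (φ j)) * conj (∑ j, (c' j : ℂ) * ψ (φ j))
        = ∑ j, ∑ l, (c j * c' l : ℂ) * ψ (φ j - φ l) := by
    intro ψ
    rw [map_sum, Finset.sum_mul_sum]
    refine Finset.sum_congr rfl fun j _ => Finset.sum_congr rfl fun l _ => ?_
    rw [map_mul, Complex.conj_ofReal, sub_eq_add_neg, AddChar.map_add_eq_mul,
      AddChar.map_neg_eq_conj]
    ring
  simp only [h]
  rw [Finset.sum_comm, Complex.ofReal_mul, Complex.ofReal_sum, Finset.mul_sum]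
  refine Finset.sum_congr rfl fun j _ => ?_
  rw [Finset.sum_comm, Complex.ofReal_sum, Finset.mul_sum]
  refine Finset.sum_congr rfl fun l _ => ?_
  rw [← Finset.mul_sum, AddChar.sum_apply_eq_ite]
  simp only [sub_eq_zero]
  split_ifs <;> simp [mul_comm]

/-- The random linear functional `x ↦ ∑ xᵢ ψ(φ i)` attached to a character `ψ`. -/
noncomputable def charSum {G J : Type*} [AddCommGroup G] [Fintype J] (φ : J → G)
    (ψ : AddChar G ℂ) (x : J → ℝ) : ℂ := ∑ j, (x j : ℂ) * ψ (φ j)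

/-- Any coincidence of pairwise sums of `φ` is trivial. -/
def IsSidonMap {G J : Type*} [Add G] (φ : J → G) : Prop :=
  ∀ i k j l, φ i + φ k = φ j + φ l → (i = j ∧ k = l) ∨ (i = l ∧ k = j)

lemma IsSidonMap.injective {G J : Type*} [Add G] {φ : J → G} (hφ : IsSidonMap φ) :
    Function.Injective φ := by
  intro i j h
  rcases hφ i i j j (by rw [h]) with h | h <;> exact h.1

section Sidon

variable {G J : Type*} [AddCommGroup G] [Fintype G] [Fintype J]

lemma sum_re_charSum_mul_conj {φ : J → G} (hφ : IsSidonMap φ) (x y : J → ℝ) :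
    ∑ ψ : AddChar G ℂ, (charSum φ ψ x * conj (charSum φ ψ y)).re
      = Fintype.card G * ∑ j, x j * y j := by
  classical
  have h := congrArg Complex.re (sum_addChar_mul_conj φ x y)
  rw [Complex.ofReal_re, Complex.re_sum] at h
  simp only [charSum, h]
  congr 1
  refine Finset.sum_congr rfl fun j _ => ?_
  simp [hφ.injective.eq_iff]

lemma sum_normSq_charSum_sq_le {φ : J → G} (hφ : IsSidonMap φ) (x : J → ℝ) :
    ∑ ψ : AddChar G ℂ, Complex.normSq (charSum φ ψ x) ^ 2
      ≤ Fintype.card G * (2 * (∑ j, x j ^ 2) ^ 2) := by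
  classical
  have hsq : ∀ ψ : AddChar G ℂ, charSum φ ψ x ^ 2
      = ∑ a : J × J, ((x a.1 * x a.2 : ℝ) : ℂ) * ψ (φ a.1 + φ a.2) := by
    intro ψ
    rw [pow_two, charSum, Finset.sum_mul_sum, Fintype.sum_prod_type]
    refine Finset.sum_congr rfl fun j _ => Finset.sum_congr rfl fun l _ => ?_
    rw [AddChar.map_add_eq_mul, Complex.ofReal_mul]
    ring
  have h := congrArg Complex.re (sum_addChar_mul_conj (fun a : J × J => φ a.1 + φ a.2)
    (fun a => x a.1 * x a.2) fun a => x a.1 * x a.2)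
  simp only [← hsq, Complex.mul_conj] at h
  rw [Complex.ofReal_re, Complex.re_sum] at h
  simp only [Complex.ofReal_re, map_pow] at h
  rw [h]
  gcongr
  have hle : ∀ a b : J × J,
      (if φ a.1 + φ a.2 = φ b.1 + φ b.2 then x a.1 * x a.2 * (x b.1 * x b.2) else 0)
        ≤ (if b = a then x a.1 ^ 2 * x a.2 ^ 2 else 0)
          + if b = a.swap then x a.1 ^ 2 * x a.2 ^ 2 else 0 := by
    rintro ⟨i, k⟩ ⟨j, l⟩
    have hnn : 0 ≤ x i ^ 2 * x k ^ 2 := by positivity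
    by_cases hs : φ i + φ k = φ j + φ l
    · rw [if_pos hs]
      rcases hφ i k j l hs with ⟨rfl, rfl⟩ | ⟨rfl, rfl⟩
      · simp only [if_true]
        split_ifs <;> nlinarith
      · simp only [Prod.swap, if_true]
        split_ifs <;> nlinarith
    · rw [if_neg hs]
      split_ifs <;> simp only [add_zero, zero_add] <;> positivity
  calc _ ≤ ∑ a : J × J, ∑ b : J × J, ((if b = a then x a.1 ^ 2 * x a.2 ^ 2 else 0)
          + if b = a.swap then x a.1 ^ 2 * x a.2 ^ 2 else 0) :=
        Finset.sum_le_sum fun a _ => Finset.sum_le_sum fun b _ => hle a b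
    _ = ∑ a : J × J, 2 * (x a.1 ^ 2 * x a.2 ^ 2) := by
        refine Finset.sum_congr rfl fun a _ => ?_
        rw [Finset.sum_add_distrib, Finset.sum_ite_eq' _ a, Finset.sum_ite_eq' _ a.swap]
        simp only [Finset.mem_univ, if_true]
        ring
    _ = _ := by
        rw [← Finset.mul_sum, Fintype.sum_prod_type, pow_two (∑ j, x j ^ 2), Finset.sum_mul_sum]

end Sidon

lemma unifProb_abs_sum_gt_le {A : Type*} [Fintype A] [Nonempty A] (f : A → ℝ) {V : ℝ}
    (hf : ∑ a, f a = 0) (hV : ∑ a, f a ^ 2 ≤ Fintype.card A * V) {k : ℕ} (hk : 0 < k) {κ : ℝ}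
    (hκ : 0 < κ) :
    unifProb (fun ω : Fin k → A => k * κ < |∑ i, f (ω i)|) ≤ V / (k * κ ^ 2) := by
  have hc : (0 : ℝ) < Fintype.card A := by exact_mod_cast Fintype.card_pos
  have hk' : (0 : ℝ) < k := by exact_mod_cast hk
  have h := sum_prod_weight_mul_sq (n := k) (fun _ (_ : A) => ((Fintype.card A : ℝ))⁻¹)
    (fun _ => f) (by intro i; simp) (by intro i; rw [← Finset.mul_sum, hf, mul_zero])
  simp only [Finset.prod_const, Finset.card_univ, Fintype.card_fin, ← Finset.mul_sum,
    Finset.sum_const, nsmul_eq_mul] at h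
  have h2 : (∑ ω : Fin k → A, (∑ i, f (ω i)) ^ 2) / (Fintype.card (Fin k → A) : ℝ)
      = k * ((∑ a, f a ^ 2) / Fintype.card A) := by
    rw [Fintype.card_fun, Fintype.card_fin, Nat.cast_pow, div_eq_inv_mul, ← inv_pow, h]
    ring
  have h3 : (∑ a, f a ^ 2) / Fintype.card A ≤ V := by
    rw [div_le_iff₀' hc]; exact hV
  calc _ ≤ (∑ ω : Fin k → A, (∑ i, f (ω i)) ^ 2 / (k * κ) ^ 2) / Fintype.card (Fin k → A) := by
        refine unifProb_le_of_indicator_le (fun _ => by positivity) fun ω hω => ?_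
        rw [one_le_div (by positivity), ← sq_abs (∑ i, f (ω i))]
        gcongr
    _ = k * ((∑ a, f a ^ 2) / Fintype.card A) / (k * κ) ^ 2 := by
        rw [← Finset.sum_div, div_right_comm, h2]
    _ ≤ k * V / (k * κ) ^ 2 := by gcongr
    _ = _ := by field_simp

/-- A random linear map into `ℝ^(2 * k)` whose rows are real and imaginary parts of `charSum`. -/
noncomputable def charSketch {G J : Type*} [AddCommGroup G] [Fintype J] (φ : J → G) {k : ℕ}
    (ψ : Fin k → AddChar G ℂ) (x : J → ℝ) (i : Fin k × Bool) : ℝ :=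
  (if i.2 then (charSum φ (ψ i.1) x).re else (charSum φ (ψ i.1) x).im) / √k

lemma sum_charSketch_mul {G J : Type*} [AddCommGroup G] [Fintype J] (φ : J → G) {k : ℕ}
    (ψ : Fin k → AddChar G ℂ) (x y : J → ℝ) :
    ∑ i, charSketch φ ψ x i * charSketch φ ψ y i
      = (∑ i, (charSum φ (ψ i) x * conj (charSum φ (ψ i) y)).re) / k := by
  rw [Fintype.sum_prod_type, Finset.sum_div]
  refine Finset.sum_congr rfl fun i _ => ?_
  rw [Fintype.sum_bool]
  simp only [charSketch, if_true, Bool.false_eq_true, if_false, Complex.mul_re, Complex.conj_re,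
    Complex.conj_im]
  rw [div_mul_div_comm, div_mul_div_comm, Real.mul_self_sqrt (Nat.cast_nonneg k)]
  ring

lemma unifProb_charSketch_inner_le {G J : Type*} [AddCommGroup G] [Fintype G] [Fintype J]
    {φ : J → G} (hφ : IsSidonMap φ) {k : ℕ} (hk : 0 < k) {κ : ℝ} (hκ : 0 < κ) (x y : J → ℝ)
    (hx : ∑ j, x j ^ 2 = 1) (hy : ∑ j, y j ^ 2 = 1) :
    unifProb (fun ψ : Fin k → AddChar G ℂ =>
      κ < |∑ i, charSketch φ ψ x i * charSketch φ ψ y i - ∑ j, x j * y j|) ≤ 2 / (k * κ ^ 2) := by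
  have hk' : (0 : ℝ) < k := by exact_mod_cast hk
  set s := ∑ j, x j * y j with hs
  set g : AddChar G ℂ → ℝ := fun ψ => (charSum φ ψ x * conj (charSum φ ψ y)).re with hg
  have hg1 : ∑ ψ, g ψ = Fintype.card G * s := sum_re_charSum_mul_conj hφ x y
  have hcard : (Fintype.card (AddChar G ℂ) : ℝ) = Fintype.card G := by
    exact_mod_cast AddChar.card_eq
  have hg2 : ∑ ψ, g ψ ^ 2 ≤ Fintype.card G * 2 := by
    calc ∑ ψ, g ψ ^ 2
        ≤ ∑ ψ, (Complex.normSq (charSum φ ψ x) ^ 2 + Complex.normSq (charSum φ ψ y) ^ 2) / 2 := by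
          refine Finset.sum_le_sum fun ψ _ => ?_
          have h1 : g ψ ^ 2 ≤ Complex.normSq (charSum φ ψ x) * Complex.normSq (charSum φ ψ y) := by
            rw [← Complex.normSq_conj (charSum φ ψ y), ← Complex.normSq_mul, Complex.normSq_apply]
            simp only [hg]
            nlinarith [mul_self_nonneg (charSum φ ψ x * conj (charSum φ ψ y)).im]
          nlinarith [sq_nonneg (Complex.normSq (charSum φ ψ x) - Complex.normSq (charSum φ ψ y))]
      _ ≤ _ := by
          rw [← Finset.sum_div, Finset.sum_add_distrib]
          have h1 := sum_normSq_charSum_sq_le hφ x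
          have h2 := sum_normSq_charSum_sq_le hφ y
          rw [hx] at h1
          rw [hy] at h2
          linarith
  have h := unifProb_abs_sum_gt_le (fun ψ => g ψ - s) (V := 2) (k := k) (κ := κ)
    (by rw [Finset.sum_sub_distrib, hg1]; simp) ?_ hk hκ
  · refine (unifProb_mono fun ψ hψ => ?_).trans h
    rw [sum_charSketch_mul] at hψ
    rw [Finset.sum_sub_distrib]
    simp only [Finset.sum_const, Finset.card_univ, Fintype.card_fin, nsmul_eq_mul]
    rw [← mul_lt_mul_iff_right₀ hk', ← abs_of_pos hk', ← abs_mul, abs_of_pos hk'] at hψ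
    rwa [mul_sub, mul_div_cancel₀ _ hk'.ne'] at hψ
  · have : ∑ ψ, (g ψ - s) ^ 2 = ∑ ψ, g ψ ^ 2 - Fintype.card G * s ^ 2 := by
      have : ∀ ψ, (g ψ - s) ^ 2 = g ψ ^ 2 - 2 * s * g ψ + s ^ 2 := fun ψ => by ring
      simp only [this]
      rw [Finset.sum_add_distrib, Finset.sum_sub_distrib, ← Finset.mul_sum, hg1]
      simp only [Finset.sum_const, Finset.card_univ, nsmul_eq_mul, hcard]
      ring
    rw [this, hcard]
    nlinarith [mul_nonneg (Nat.cast_nonneg (α := ℝ) (Fintype.card G)) (sq_nonneg s)]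

lemma unifProb_not_nearGram_le {G J : Type*} [AddCommGroup G] [Fintype G] [Fintype J]
    {φ : J → G} (hφ : IsSidonMap φ) {k : ℕ} (hk : 0 < k) {κ : ℝ} (hκ : 0 < κ) (x y : J → ℝ)
    (hx : ∑ j, x j ^ 2 = 1) (hy : ∑ j, y j ^ 2 = 1) :
    unifProb (fun ψ : Fin k → AddChar G ℂ =>
      ¬ NearGram κ (∑ j, x j * y j) (charSketch φ ψ x) (charSketch φ ψ y))
        ≤ 6 / (k * κ ^ 2) := by
  have h1 := unifProb_charSketch_inner_le hφ hk hκ x x hx hx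
  have h2 := unifProb_charSketch_inner_le hφ hk hκ y y hy hy
  have h3 := unifProb_charSketch_inner_le hφ hk hκ x y hx hy
  simp only [← pow_two, hx] at h1
  simp only [← pow_two, hy] at h2
  have h4 : 6 / (k * κ ^ 2) = 2 / (k * κ ^ 2) + (2 / (k * κ ^ 2) + 2 / (k * κ ^ 2)) := by ring
  rw [h4]
  refine le_trans ?_ (add_le_add h1 ((unifProb_or_le _ _).trans (add_le_add h2 h3)))
  refine (unifProb_mono fun ψ hψ => ?_).trans (unifProb_or_le _ _)
  by_contra hcon
  push Not at hcon
  exact hψ ⟨hcon.1, hcon.2.1, hcon.2.2⟩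

lemma isSidonMap_natCast_sq (d : ℕ) :
    IsSidonMap (fun i : Fin d =>
      (((i : ℕ) : ZMod (2 * d ^ 2 + 1)), (((i : ℕ) ^ 2 : ℕ) : ZMod (2 * d ^ 2 + 1)))) := by
  intro i k j l h
  have hi := i.2
  have hk := k.2
  have hj := j.2
  have hl := l.2
  rw [Prod.mk_add_mk, Prod.mk_add_mk, Prod.mk.injEq] at h
  obtain ⟨h1, h2⟩ := h
  rw [← Nat.cast_add, ← Nat.cast_add, ZMod.natCast_eq_natCast_iff'] at h1 h2
  rw [Nat.mod_eq_of_lt (by nlinarith), Nat.mod_eq_of_lt (by nlinarith)] at h1 h2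
  have h3 : ((i : ℤ) - j) * ((i : ℤ) - l) = 0 := by
    zify at h1 h2
    have : (k : ℤ) = j + l - i := by linarith
    rw [this] at h2
    linarith
  rcases mul_eq_zero.mp h3 with h | h
  · left; constructor <;> ext <;> lia
  · right; constructor <;> ext <;> lia

/-- The vector with entries `sᵢ / √n`, each repeated `n` times. -/
noncomputable def spread {ι : Type*} [Fintype ι] (n : ℕ) (s : ι → ℝ) :
    Fin (Fintype.card (ι × Fin n)) → ℝ :=
  fun i => s ((Fintype.equivFin (ι × Fin n)).symm i).1 / √n

lemma sum_spread_mul {ι : Type*} [Fintype ι] {n : ℕ} (hn : 0 < n) (s s' : ι → ℝ) :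
    ∑ i, spread n s i * spread n s' i = ∑ i, s i * s' i := by
  have hn' : (0 : ℝ) < n := by exact_mod_cast hn
  unfold spread
  rw [(Fintype.equivFin (ι × Fin n)).symm.sum_comp fun p => s p.1 / √n * (s' p.1 / √n),
    Fintype.sum_prod_type]
  refine Finset.sum_congr rfl fun i _ => ?_
  simp only [Finset.sum_const, Finset.card_univ, Fintype.card_fin, nsmul_eq_mul]
  rw [div_mul_div_comm, Real.mul_self_sqrt hn'.le]
  field_simp

lemma NearGram.spread {ι : Type*} [Fintype ι] {n : ℕ} (hn : 0 < n) {κ a : ℝ} {s s' : ι → ℝ}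
    (h : NearGram κ a s s') : NearGram κ a (spread n s) (spread n s') := by
  simpa only [NearGram, pow_two, sum_spread_mul hn] using h

lemma abs_spread_le {ι : Type*} [Fintype ι] {n : ℕ} {η : ℝ} (hη : 0 < η)
    (hn : 2 / η ^ 2 ≤ n) {s : ι → ℝ} (hs : ∑ i, s i ^ 2 ≤ 2) (i) : |spread n s i| ≤ η := by
  have hn' : (0 : ℝ) < n := lt_of_lt_of_le (by positivity) hn
  apply abs_le_of_sq_le_sq _ hη.le
  rw [spread, div_pow, Real.sq_sqrt hn'.le, div_le_iff₀ hn']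
  rw [div_le_iff₀ (by positivity)] at hn
  have := Finset.single_le_sum (f := fun i => s i ^ 2) (fun i _ => sq_nonneg _)
    (Finset.mem_univ ((Fintype.equivFin (ι × Fin n)).symm i).1)
  linarith

/-! ### The hash family -/

lemma eventually_card_le (k m T : ℕ) :
    ∀ᶠ d : ℕ in atTop, ((2 * d ^ 2 + 1) ^ 2) ^ k * (2 ^ m) ^ T ≤ 2 ^ ⌈(Real.log d) ^ 9⌉₊ := by
  have hL : Tendsto (fun d : ℕ => Real.log d) atTop atTop :=
    Real.tendsto_log_atTop.comp tendsto_natCast_atTop_atTop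
  set c : ℝ := 8 * k + m * T with hc
  have hc0 : 0 ≤ c := by positivity
  filter_upwards [hL.eventually_ge_atTop (1 + 4 * c), eventually_ge_atTop 1] with d hd hd1
  have hd0 : (1 : ℝ) ≤ d := by exact_mod_cast hd1
  set L := Real.log d with hLd
  have hL1 : 1 ≤ L := by linarith
  have h2 : (2 : ℝ) ≤ Real.exp 1 := by linarith [Real.add_one_le_exp 1]
  have h1 : (2 * (d : ℝ) ^ 2 + 1) ≤ Real.exp (2 + 2 * L) := by
    calc (2 * (d : ℝ) ^ 2 + 1) ≤ 2 ^ 2 * (d : ℝ) ^ 2 := by nlinarith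
      _ = 2 ^ 2 * Real.exp L ^ 2 := by rw [hLd, Real.exp_log (by linarith)]
      _ ≤ Real.exp 1 ^ 2 * Real.exp L ^ 2 := by gcongr
      _ = Real.exp (2 + 2 * L) := by
        rw [← Real.exp_nat_mul, ← Real.exp_nat_mul, ← Real.exp_add]; norm_num
  have key : (((2 * d ^ 2 + 1) ^ 2) ^ k * (2 ^ m) ^ T : ℝ) ≤ 2 ^ ⌈L ^ 9⌉₊ := by
    calc (((2 * d ^ 2 + 1) ^ 2) ^ k * (2 ^ m) ^ T : ℝ)
        ≤ (Real.exp (2 + 2 * L) ^ 2) ^ k * (Real.exp 1 ^ m) ^ T := by gcongr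
      _ = Real.exp (k * (2 * (2 + 2 * L)) + T * (m * 1)) := by
          rw [← Real.exp_nat_mul, ← Real.exp_nat_mul, ← Real.exp_nat_mul, ← Real.exp_nat_mul,
            ← Real.exp_add]
          norm_num
      _ ≤ Real.exp (Real.log 2 * ⌈L ^ 9⌉₊) := by
          apply Real.exp_le_exp.mpr
          have e1 : (k : ℝ) * (2 * (2 + 2 * L)) + T * (m * 1) ≤ c * L := by
            rw [hc]
            have := mul_nonneg (Nat.cast_nonneg (α := ℝ) m) (Nat.cast_nonneg (α := ℝ) T)
            nlinarith [Nat.cast_nonneg (α := ℝ) k]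
          have e2 : L ^ 2 ≤ ⌈L ^ 9⌉₊ :=
            (pow_le_pow_right₀ hL1 (by norm_num)).trans (Nat.le_ceil _)
          have e3 := Real.log_two_gt_d9
          nlinarith
      _ = 2 ^ ⌈L ^ 9⌉₊ := by
          rw [mul_comm, Real.exp_nat_mul, Real.exp_log two_pos]
  exact_mod_cast key

/-- A hash family on `ℝ^d` within the allowed budget of seeds and values. -/
structure HashFamily (d : ℕ) where
  /-- The number of seeds. -/
  N : ℕ
  /-- The number of hash values. -/
  M : ℕ
  /-- The hash functions. -/
  hash : Fin N → EuclideanSpace ℝ (Fin d) → Fin M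
  seeds_le : N ≤ 2 ^ ⌈(Real.log d) ^ 9⌉₊
  values_le : (M : ℝ) ≤ (Real.log d) ^ 4

lemma inner_eq_of_norm_sub {d : ℕ} {x y : EuclideanSpace ℝ (Fin d)} {r : ℝ} (hx : ‖x‖ = 1)
    (hy : ‖y‖ = 1) (hxy : ‖x - y‖ = r) : ∑ i, x i * y i = 2 - r ^ 2 / 2 - 1 := by
  have h := norm_sub_sq_real x y
  rw [hx, hy, hxy, PiLp.inner_apply] at h
  have : ∑ i, inner ℝ (x i) (y i) = ∑ i, x i * y i :=
    Finset.sum_congr rfl fun i _ => by simp [mul_comm]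
  linarith

lemma exists_hashFamily {b t : ℝ} (hb : 0 < b) (hb2 : b ≤ 2) (ht : 0 ≤ t) :
    ∀ᶠ d : ℕ in atTop, ∃ H : HashFamily d, ∀ r, b ≤ 2 - r ^ 2 / 2 →
      ∀ x y : EuclideanSpace ℝ (Fin d), ‖x‖ = 1 → ‖y‖ = 1 → ‖x - y‖ = r →
      |Real.log (1 / collisionFraction H.hash x y) - t ^ 2 * (1 / (2 - r ^ 2 / 2) - 1 / 2)|
        ≤ logError b t + 3 := by
  obtain ⟨κ, hκ, hκ1, η, hη, T, hT⟩ := exists_firstHit_bounds hb hb2 ht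
  set δ := min (1 / 2) (Real.exp (-t ^ 2 / b)) with hδ
  have hδ0 : 0 < δ := lt_min (by norm_num) (Real.exp_pos _)
  have hD := logError_ge hb ht
  set k := ⌈6 / (κ ^ 2 * δ)⌉₊ + 1 with hk
  have hk0 : 0 < k := Nat.succ_pos _
  have hkδ : 6 / (k * κ ^ 2) ≤ δ := by
    have h1 : 6 / (κ ^ 2 * δ) ≤ k :=
      (Nat.le_ceil _).trans (by exact_mod_cast Nat.le_succ _)
    rw [div_le_iff₀ (by positivity)] at h1 ⊢
    linarith
  set n := ⌈2 / η ^ 2⌉₊ + 1 with hn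
  have hn0 : 0 < n := Nat.succ_pos _
  have hnη : 2 / η ^ 2 ≤ n := (Nat.le_ceil _).trans (by exact_mod_cast Nat.le_succ _)
  have hL : Tendsto (fun d : ℕ => Real.log d) atTop atTop :=
    Real.tendsto_log_atTop.comp tendsto_natCast_atTop_atTop
  filter_upwards [eventually_card_le k (Fintype.card ((Fin k × Bool) × Fin n)) T,
    hL.eventually_ge_atTop (T + 1)] with d hN hM
  set φ : Fin d → ZMod (2 * d ^ 2 + 1) × ZMod (2 * d ^ 2 + 1) :=
    fun i => (((i : ℕ) : ZMod (2 * d ^ 2 + 1)), (((i : ℕ) ^ 2 : ℕ) : ZMod (2 * d ^ 2 + 1)))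
  have hφ : IsSidonMap φ := isSidonMap_natCast_sq d
  let Ω := (Fin k → AddChar (ZMod (2 * d ^ 2 + 1) × ZMod (2 * d ^ 2 + 1)) ℂ) ×
    (Fin T → Fin (Fintype.card ((Fin k × Bool) × Fin n)) → Bool)
  let h : Ω → EuclideanSpace ℝ (Fin d) → Fin (T + 1) := fun ω x =>
    firstHit T fun i => t ≤ signedSum (spread n (charSketch φ ω.1 (fun j => x j))) (ω.2 i)
  let e : Fin (Fintype.card Ω) ≃ Ω := (Fintype.equivFin Ω).symm
  refine ⟨⟨Fintype.card Ω, T + 1, fun ω x => h (e ω) x, ?_, ?_⟩, ?_⟩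
  · refine le_trans (le_of_eq ?_) hN
    simp only [Ω, Fintype.card_prod, Fintype.card_fun, AddChar.card_eq, ZMod.card, Fintype.card_fin,
      Fintype.card_bool]
    ring
  · push_cast
    have hL1 : 1 ≤ Real.log d := by linarith [Nat.cast_nonneg (α := ℝ) T]
    exact hM.trans (le_self_pow₀ hL1 (by norm_num))
  intro r hr x y hx hy hxy
  set β := 2 - r ^ 2 / 2 with hβ
  have hβ0 : 0 < β := hb.trans_le hr
  rw [collisionFraction_eq_unifProb, unifProb_comp_equiv e fun ω => h ω x = h ω y]
  set p := unifProb fun ω => h ω x = h ω y with hp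
  have hsx : ∑ j, x j ^ 2 = 1 := by rw [← EuclideanSpace.real_norm_sq_eq, hx, one_pow]
  have hsy : ∑ j, y j ^ 2 = 1 := by rw [← EuclideanSpace.real_norm_sq_eq, hy, one_pow]
  have hbad := (unifProb_not_nearGram_le hφ hk0 hκ (fun j => x j) (fun j => y j) hsx hsy).trans hkδ
  rw [inner_eq_of_norm_sub hx hy hxy] at hbad
  have hgood := fun
      (ψ : Fin k → AddChar (ZMod (2 * d ^ 2 + 1) × ZMod (2 * d ^ 2 + 1)) ℂ)
      (hψ : ¬ ¬ NearGram κ (β - 1) (charSketch φ ψ fun j => x j)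
        (charSketch φ ψ fun j => y j)) => by
    have hng : NearGram κ (β - 1) (charSketch φ ψ fun j => x j) (charSketch φ ψ fun j => y j) :=
      not_not.mp hψ
    exact hT β hr _ _ _ (hng.spread hn0)
      (abs_spread_le hη hnη (by linarith [(abs_le.mp hng.1).2]))
      (abs_spread_le hη hnη (by linarith [(abs_le.mp hng.2.1).2]))
  have hup : p ≤ δ + _ := unifProb_prod_le (fun ω : Ω => h ω x = h ω y) _ (by positivity) hbad
    fun ψ hψ => (hgood ψ hψ).2
  have hlo : (1 - δ) * _ ≤ p := le_unifProb_prod (fun ω : Ω => h ω x = h ω y) _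
    (Real.exp_pos _).le hbad fun ψ hψ => (hgood ψ hψ).1
  set E := t ^ 2 * (1 / β - 1 / 2) with hE
  have hEneg : -t ^ 2 * (1 / β - 1 / 2) = -E := by rw [hE]; ring
  rw [hEneg] at hup hlo
  have hlo' : Real.exp (-E - logError b t - 3) ≤ p := by
    calc Real.exp (-E - logError b t - 3) = Real.exp (-1) * Real.exp (-E - logError b t - 2) := by
          rw [← Real.exp_add]; ring_nf
      _ ≤ (1 - δ) * Real.exp (-E - logError b t - 2) := by
          gcongr
          linarith [Real.exp_neg_one_lt_d9, min_le_left (1 / 2) (Real.exp (-t ^ 2 / b))]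
      _ ≤ p := hlo
  have hup' : p ≤ Real.exp (-E + logError b t + 3) := by
    have hδE : δ ≤ Real.exp (-E + logError b t + 1) := by
      refine (min_le_right _ _).trans (Real.exp_le_exp.mpr ?_)
      have : t ^ 2 / β ≤ t ^ 2 / b := by gcongr
      have h3 : E = t ^ 2 / β - t ^ 2 / 2 := by rw [hE]; ring
      rw [neg_div, h3]
      nlinarith [sq_nonneg t]
    calc p ≤ 3 * Real.exp (-E + logError b t + 1) := by linarith
      _ ≤ Real.exp 2 * Real.exp (-E + logError b t + 1) := by
          gcongr; linarith [Real.add_one_le_exp 2]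
      _ = _ := by rw [← Real.exp_add]; ring_nf
  have hp0 : 0 < p := (Real.exp_pos _).trans_le hlo'
  rw [one_div, Real.log_inv]
  have h1 := (Real.le_log_iff_exp_le hp0).mpr hlo'
  have h2 := (Real.log_le_iff_le_exp hp0).mpr hup'
  exact abs_le.mpr ⟨by linarith, by linarith⟩

lemma abs_div_sub_div_le {a₁ a₂ e₁ e₂ F ε : ℝ} (ha₁ : 0 < a₁) (ha₂ : 0 < a₂)
    (h₁ : |e₁ - a₁| ≤ F) (h₂ : |e₂ - a₂| ≤ F) (hF : 2 * F ≤ a₂)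
    (hε : 2 * F * (a₁ + a₂) ≤ ε * a₂ ^ 2) : |e₁ / e₂ - a₁ / a₂| ≤ ε := by
  obtain ⟨h1, h1'⟩ := abs_le.mp h₁
  obtain ⟨h2, h2'⟩ := abs_le.mp h₂
  have he₂ : a₂ / 2 ≤ e₂ := by linarith
  have he₂0 : 0 < e₂ := by linarith
  have hF0 : 0 ≤ F := (abs_nonneg _).trans h₁
  have hε0 : 0 ≤ ε := by
    by_contra hneg
    push Not at hneg
    have : 0 ≤ 2 * F * (a₁ + a₂) := by positivity
    nlinarith [pow_pos ha₂ 2]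
  rw [div_sub_div _ _ he₂0.ne' ha₂.ne', abs_div, abs_of_pos (mul_pos he₂0 ha₂),
    div_le_iff₀ (mul_pos he₂0 ha₂)]
  have hnum : |e₁ * a₂ - e₂ * a₁| ≤ F * (a₁ + a₂) := by
    rw [abs_le]
    constructor <;> nlinarith
  have : ε * (a₂ / 2 * a₂) ≤ ε * (e₂ * a₂) := by gcongr
  linarith

lemma exists_hashFamily_ratio {r₁ r₂ : ℝ} (h₁ : 0 < r₁) (h₁' : r₁ < 2) (h₂ : 0 < r₂)
    (h₂' : r₂ < 2) {ε : ℝ} (hε : 0 < ε) :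
    ∀ᶠ d : ℕ in atTop, ∃ H : HashFamily d, ∀ x y x' y' : EuclideanSpace ℝ (Fin d),
      ‖x‖ = 1 → ‖y‖ = 1 → ‖x - y‖ = r₁ → ‖x'‖ = 1 → ‖y'‖ = 1 → ‖x' - y'‖ = r₂ →
      |Real.log (1 / collisionFraction H.hash x y) / Real.log (1 / collisionFraction H.hash x' y')
        - (1 / (2 - r₁ ^ 2 / 2) - 1 / 2) / (1 / (2 - r₂ ^ 2 / 2) - 1 / 2)| ≤ ε := by
  set β₁ := 2 - r₁ ^ 2 / 2 with hβ₁
  set β₂ := 2 - r₂ ^ 2 / 2 with hβ₂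
  have hβ₁0 : 0 < β₁ := by nlinarith
  have hβ₂0 : 0 < β₂ := by nlinarith
  have hβ₁2 : β₁ < 2 := by nlinarith
  have hβ₂2 : β₂ < 2 := by nlinarith
  set E₁ := 1 / β₁ - 1 / 2 with hE₁
  set E₂ := 1 / β₂ - 1 / 2 with hE₂
  have hE₁0 : 0 < E₁ := sub_pos.mpr (one_div_lt_one_div_of_lt hβ₁0 hβ₁2)
  have hE₂0 : 0 < E₂ := sub_pos.mpr (one_div_lt_one_div_of_lt hβ₂0 hβ₂2)
  set b := min β₁ β₂ with hb
  have hb0 : 0 < b := lt_min hβ₁0 hβ₂0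
  set K := 39 / b + 6 with hK
  have hK0 : 0 < K := by positivity
  set t := 1 + 2 * K / E₂ + 2 * K * (E₁ + E₂) / (ε * E₂ ^ 2) with ht
  have p1 : 0 < 2 * K / E₂ := by positivity
  have p2 : 0 < 2 * K * (E₁ + E₂) / (ε * E₂ ^ 2) := by positivity
  have ht1 : 1 ≤ t := by linarith
  have ht2 : 2 * K ≤ t * E₂ := by
    rw [← div_le_iff₀ hE₂0]; linarith
  have ht3 : 2 * K * (E₁ + E₂) ≤ t * (ε * E₂ ^ 2) := by
    rw [← div_le_iff₀ (by positivity)]; linarith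
  have hF : logError b t + 3 ≤ K * t := by
    have : (12 * t + 27) / b ≤ 39 * t / b := by gcongr; linarith
    have h3 : K * t = 39 * t / b + 6 * t := by rw [hK]; ring
    rw [h3]; unfold logError; linarith
  filter_upwards [exists_hashFamily hb0 ((min_le_left _ _).trans hβ₁2.le)
    (show 0 ≤ t by linarith)] with d ⟨H, hH⟩
  refine ⟨H, fun x y x' y' hx hy hxy hx' hy' hxy' => ?_⟩
  have e1 := (hH r₁ (min_le_left _ _) x y hx hy hxy).trans hF
  have e2 := (hH r₂ (min_le_right _ _) x' y' hx' hy' hxy').trans hF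
  have htt : (0 : ℝ) < t ^ 2 := by positivity
  have hdiv : E₁ / E₂ = t ^ 2 * E₁ / (t ^ 2 * E₂) := by field_simp
  rw [hdiv]
  refine abs_div_sub_div_le (by positivity) (by positivity) e1 e2 ?_ ?_
  · nlinarith
  · have := mul_le_mul_of_nonneg_left ht3 (show 0 ≤ t ^ 3 by positivity)
    linarith

/-- Families that are eventually `ε`-good for each `ε` can be merged into one. -/
lemma exists_forall_eventually_of_eventually_exists {F : ℕ → Type*} [∀ d, Nonempty (F d)]
    (Q : ∀ d, F d → ℝ → Prop) (hmono : ∀ d f ε ε', ε ≤ ε' → Q d f ε → Q d f ε')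
    (hQ : ∀ ε > 0, ∀ᶠ d in atTop, ∃ f, Q d f ε) :
    ∃ f : ∀ d, F d, ∀ ε > 0, ∀ᶠ d in atTop, Q d (f d) ε := by
  classical
  set J : ℕ → ℕ := fun d => Nat.findGreatest (fun j => ∃ f, Q d f (1 / (j + 1))) d with hJ
  have hex : ∀ d, ∃ f, J d ≠ 0 → Q d f (1 / (J d + 1)) := by
    intro d
    by_cases h : J d = 0
    · exact ⟨Classical.arbitrary _, fun h' => absurd h h'⟩
    · obtain ⟨f, hf⟩ := Nat.findGreatest_of_ne_zero (n := d)
        (P := fun j => ∃ f, Q d f (1 / ((j : ℝ) + 1))) rfl h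
      exact ⟨f, fun _ => hf⟩
  choose f hf using hex
  refine ⟨f, fun ε hε => ?_⟩
  obtain ⟨j, hj⟩ := exists_nat_one_div_lt hε
  have hpos : (0 : ℝ) < 1 / (((j + 1 : ℕ) : ℝ) + 1) := by positivity
  filter_upwards [hQ _ hpos, eventually_ge_atTop (j + 1)] with d hd hjd
  have hle : j + 1 ≤ J d :=
    Nat.le_findGreatest (P := fun j => ∃ f, Q d f (1 / ((j : ℝ) + 1))) hjd hd
  refine hmono d _ _ _ ?_ (hf d (by lia))
  have hle' : (j : ℝ) + 1 ≤ J d := by exact_mod_cast hle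
  refine le_trans ?_ hj.le
  gcongr
  linarith

end

/-- Fast discrete cross-polytope LSH with few random bits (Theorem 3.2): there is a hash
family on `S^{d−1}` with at most `2^{⌈C(ln d)⁹⌉}` seeds (i.e. `O((ln d)⁹)` random bits) and
at most `C(ln d)⁴` hash values whose sensitivity exponent tends to the optimal value
`(1/c²)·(4 − c²R²)/(4 − R²)` as `d → ∞`. -/
theorem stmt_2 (R c : ℝ) (hR : 0 < R) (hR2 : R < 2) (hc : 1 < c) (hcR : c * R < 2) :
    ∃ C : ℝ, 0 < C ∧
      ∃ (N M : ℕ → ℕ)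
        (h : (d : ℕ) → Fin (N d) → EuclideanSpace ℝ (Fin d) → Fin (M d)),
        (∀ d : ℕ, N d ≤ 2 ^ ⌈C * (Real.log d) ^ 9⌉₊) ∧
        (∀ d : ℕ, (M d : ℝ) ≤ C * (Real.log d) ^ 4) ∧
        ∀ (x y x' y' : (d : ℕ) → EuclideanSpace ℝ (Fin d)),
          (∀ d, 2 ≤ d → ‖x d‖ = 1) → (∀ d, 2 ≤ d → ‖y d‖ = 1) →
          (∀ d, 2 ≤ d → ‖x d - y d‖ = R) →
          (∀ d, 2 ≤ d → ‖x' d‖ = 1) → (∀ d, 2 ≤ d → ‖y' d‖ = 1) →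
          (∀ d, 2 ≤ d → ‖x' d - y' d‖ = c * R) →
          Tendsto (fun d =>
              Real.log (1 / collisionFraction (h d) (x d) (y d)) /
                Real.log (1 / collisionFraction (h d) (x' d) (y' d)))
            atTop (nhds (1 / c ^ 2 * ((4 - c ^ 2 * R ^ 2) / (4 - R ^ 2)))) := by
  have hR' : 0 < c * R := by positivity
  have (d : ℕ) : Nonempty (HashFamily d) :=
    ⟨⟨0, 0, fun i => i.elim0, Nat.zero_le _, by rw [Nat.cast_zero]; positivity⟩⟩
  have hlim : 1 / c ^ 2 * ((4 - c ^ 2 * R ^ 2) / (4 - R ^ 2))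
      = (1 / (2 - R ^ 2 / 2) - 1 / 2) / (1 / (2 - (c * R) ^ 2 / 2) - 1 / 2) := by
    have h1 : 0 < 4 - R ^ 2 := by nlinarith
    have h2 : 0 < 4 - c ^ 2 * R ^ 2 := by nlinarith
    have e1 : 1 / (2 - R ^ 2 / 2) - 1 / 2 = R ^ 2 / (2 * (4 - R ^ 2)) := by
      rw [show 2 - R ^ 2 / 2 = (4 - R ^ 2) / 2 by ring]
      field_simp
      ring
    have e2 : 1 / (2 - (c * R) ^ 2 / 2) - 1 / 2 = c ^ 2 * R ^ 2 / (2 * (4 - c ^ 2 * R ^ 2)) := by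
      rw [show 2 - (c * R) ^ 2 / 2 = (4 - c ^ 2 * R ^ 2) / 2 by ring]
      field_simp
      ring
    rw [e1, e2]
    field_simp
  obtain ⟨H, hH⟩ := exists_forall_eventually_of_eventually_exists
    (fun d (H : HashFamily d) ε => ∀ x y x' y' : EuclideanSpace ℝ (Fin d),
      ‖x‖ = 1 → ‖y‖ = 1 → ‖x - y‖ = R → ‖x'‖ = 1 → ‖y'‖ = 1 → ‖x' - y'‖ = c * R →
      |Real.log (1 / collisionFraction H.hash x y) / Real.log (1 / collisionFraction H.hash x' y')
        - (1 / (2 - R ^ 2 / 2) - 1 / 2) / (1 / (2 - (c * R) ^ 2 / 2) - 1 / 2)| ≤ ε)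
    (fun _ _ _ _ hle h x y x' y' h1 h2 h3 h4 h5 h6 => (h x y x' y' h1 h2 h3 h4 h5 h6).trans hle)
    (fun _ hε => exists_hashFamily_ratio hR hR2 hR' hcR hε)
  refine ⟨1, one_pos, fun d => (H d).N, fun d => (H d).M, fun d => (H d).hash,
    fun d => by simpa using (H d).seeds_le, fun d => by simpa using (H d).values_le, ?_⟩
  intro x y x' y' hx hy hxy hx' hy' hxy'
  rw [hlim, Metric.tendsto_nhds]
  intro ε hε
  filter_upwards [hH (ε / 2) (half_pos hε), eventually_ge_atTop 2] with d hd hd2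
  rw [Real.dist_eq]
  exact (hd _ _ _ _ (hx d hd2) (hy d hd2) (hxy d hd2) (hx' d hd2) (hy' d hd2)
    (hxy' d hd2)).trans_lt (half_lt_self hε)
end
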